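/- arXiv:1211.6809 — 3 statements merged into one kernel-verified Lean document; each statement's English description precedes it below -/
import Mathlib

section
/- Let p > 0 and α > 0 satisfy pα > 1. There exists a constant C (depending only on α and p) such that for every continuous function f : [0,1] → ℝ and all s, t ∈ [0,1], |f(s) − f(t)| ≤ C |t − s|^{α − 1/p} (∫₀¹∫₀¹ |f(x) − f(y)|^p / |x − y|^{αp + 1} dx dy)^{1/p}. -/
open MeasureTheory Set

/-- Selection of a good point in a subinterval by Markov's inequality. -/
theorem grr_pick (A h : ℝ → ENNReal) (hA : Measurable A) (hh : Measurable h)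
    (M N : ℝ) (hM : 0 < M) (hN : 0 < N)
    (hAM : ∫⁻ x in Icc (0:ℝ) 1, A x ≤ ENNReal.ofReal M)
    (hhN : ∫⁻ x in Icc (0:ℝ) 1, h x ≤ ENNReal.ofReal N)
    (u l : ℝ) (hl : 0 < l) (hJ : Icc u (u + l) ⊆ Icc (0:ℝ) 1) :
    ∃ x ∈ Icc u (u + l), A x ≤ ENNReal.ofReal (4 * M / l) ∧ h x ≤ ENNReal.ofReal (4 * N / l) := by
  have key : ∀ (A : ℝ → ENNReal) (M : ℝ), Measurable A → 0 < M →
      ∫⁻ x in Icc (0:ℝ) 1, A x ≤ ENNReal.ofReal M →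
      volume.restrict (Icc (0:ℝ) 1) {x | ENNReal.ofReal (4 * M / l) ≤ A x}
        ≤ ENNReal.ofReal (l / 4) := by
    intro A M hA hM hAM
    have h0 : (0:ℝ) < 4 * M / l := by positivity
    refine (meas_ge_le_lintegral_div hA.aemeasurable (by simpa using h0)
      ENNReal.ofReal_ne_top).trans ?_
    refine (ENNReal.div_le_div_right hAM _).trans ?_
    rw [← ENNReal.ofReal_div_of_pos h0]
    apply ENNReal.ofReal_le_ofReal
    apply le_of_eq
    field_simp
  by_contra! hcon
  have hsub : Icc u (u + l) ⊆ {x | ENNReal.ofReal (4 * M / l) ≤ A x} ∪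
      {x | ENNReal.ofReal (4 * N / l) ≤ h x} := by
    intro x hx
    by_cases hx1 : A x ≤ ENNReal.ofReal (4 * M / l)
    · exact Or.inr (hcon x hx hx1).le
    · exact Or.inl (not_le.1 hx1).le
  have h1 := measure_mono (μ := volume.restrict (Icc (0:ℝ) 1)) hsub
  rw [Measure.restrict_apply measurableSet_Icc, inter_eq_left.2 hJ, Real.volume_Icc] at h1
  have h2 := h1.trans ((measure_union_le _ _).trans
    (add_le_add (key A M hA hM hAM) (key h N hh hN hhN)))
  rw [← ENNReal.ofReal_add (by positivity) (by positivity),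
    ENNReal.ofReal_le_ofReal_iff (by positivity)] at h2
  linarith

/-- One step of the chain. -/
theorem grr_step (p α : ℝ) (hp : 0 < p) (hα : 0 < α)
    (d z M l : ℝ) (hd : 0 ≤ d) (hz : 0 ≤ z) (hM : 0 < M) (hl : 0 < l)
    (hzl : z ≤ 2 * l) (hdz : z = 0 → d = 0)
    (h : ENNReal.ofReal (d ^ p / z ^ (α * p + 1)) ≤
      ENNReal.ofReal (4 * (4 * M / l) / (l / 2))) :
    d ≤ ((2:ℝ) ^ (α * p + 1) * 32) ^ (1 / p) * M ^ (1 / p) * l ^ (α - 1 / p) := by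
  rcases hz.eq_or_lt with h0 | hz
  · rw [hdz h0.symm]; positivity
  rw [ENNReal.ofReal_le_ofReal_iff (by positivity)] at h
  have hz' : 0 < z ^ (α * p + 1) := by positivity
  rw [div_le_iff₀ hz'] at h
  have h1 : z ^ (α * p + 1) ≤ (2 * l) ^ (α * p + 1) := by gcongr
  have h2 : d ^ p ≤ ((2:ℝ) ^ (α * p + 1) * 32) * M * l ^ (α * p - 1) := by
    calc d ^ p ≤ 4 * (4 * M / l) / (l / 2) * (2 * l) ^ (α * p + 1) := by
          refine h.trans ?_
          gcongr
      _ = _ := by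
          rw [Real.mul_rpow (by norm_num) hl.le,
            show α * p + 1 = (α * p - 1) + 2 by ring, Real.rpow_add hl, Real.rpow_two]
          field_simp
          ring
  have h3 : d = (d ^ p) ^ (1 / p) := by
    rw [← Real.rpow_mul hd, mul_one_div_cancel hp.ne', Real.rpow_one]
  rw [h3]
  refine (Real.rpow_le_rpow (by positivity) h2 (by positivity)).trans ?_
  rw [Real.mul_rpow (by positivity) (by positivity), Real.mul_rpow (by positivity) (by positivity),
    ← Real.rpow_mul hl.le]
  apply le_of_eq
  congr 2
  field_simp

/-- The chain converging to `e`. -/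
theorem grr_chain (p α : ℝ) (hp : 0 < p) (hα : 0 < α) (hpα : 1 < p * α)
    (f : ℝ → ℝ) (hf : Continuous f) (M L : ℝ) (hM : 0 < M) (hL : 0 < L)
    (A : ℝ → ENNReal) (hA : Measurable A)
    (hAdef : ∀ x, A x = ∫⁻ y in Icc (0:ℝ) 1,
      ENNReal.ofReal (|f x - f y| ^ p / |x - y| ^ (α * p + 1)))
    (hAM : ∫⁻ x in Icc (0:ℝ) 1, A x ≤ ENNReal.ofReal M)
    (u : ℕ → ℝ) (e : ℝ) (hu : ∀ n, Icc (u n) (u n + L / 2 ^ n) ⊆ Icc (0:ℝ) 1)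
    (he : ∀ n, e ∈ Icc (u n) (u n + L / 2 ^ n))
    (x0 : ℝ) (hx0 : x0 ∈ Icc (u 0) (u 0 + L)) (hAx0 : A x0 ≤ ENNReal.ofReal (4 * M / L)) :
    |f x0 - f e| ≤ ((2:ℝ) ^ (α * p + 1) * 32) ^ (1 / p) * M ^ (1 / p) * L ^ (α - 1 / p) /
      (1 - (1 / 2) ^ (α - 1 / p)) := by
  have hγ : 0 < α - 1 / p := by
    rw [sub_pos, div_lt_iff₀ hp]; linarith
  let P : ℕ → ℝ → Prop := fun n x =>
    x ∈ Icc (u n) (u n + L / 2 ^ n) ∧ A x ≤ ENNReal.ofReal (4 * M / (L / 2 ^ n))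
  let Q : ℕ → ℝ → ℝ → Prop := fun n x y =>
    |f x - f y| ≤ ((2:ℝ) ^ (α * p + 1) * 32) ^ (1 / p) * M ^ (1 / p) * (L / 2 ^ n) ^ (α - 1 / p)
  have hstep : ∀ n x, P n x → ∃ y, P (n + 1) y ∧ Q n x y := by
    intro n x ⟨hx, hAx⟩
    have hl : 0 < L / 2 ^ n := by positivity
    have hll : L / 2 ^ (n + 1) = L / 2 ^ n / 2 := by rw [pow_succ]; field_simp
    obtain ⟨y, hy, hy1, hy2⟩ := grr_pick A
      (fun y => ENNReal.ofReal (|f x - f y| ^ p / |x - y| ^ (α * p + 1))) hA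
      (by have := hf.measurable; fun_prop) M (4 * M / (L / 2 ^ n)) hM (by positivity) hAM
      (by rw [← hAdef]; exact hAx) (u (n + 1)) (L / 2 ^ (n + 1)) (by positivity) (hu (n + 1))
    refine ⟨y, ⟨hy, hy1⟩, ?_⟩
    rw [hll] at hy2
    refine grr_step p α hp hα _ |x - y| M (L / 2 ^ n) (abs_nonneg _) (abs_nonneg _) hM hl ?_ ?_ hy2
    · have e1 := he n
      have e2 := he (n + 1)
      rw [hll] at e2 hy
      simp only [mem_Icc] at e1 e2 hx hy
      rw [abs_le]
      constructor <;> linarith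
    · intro h
      rw [abs_eq_zero, sub_eq_zero] at h
      simp [h]
  choose! nxt h1 h2 using hstep
  let X : ℕ → ℝ := fun n => Nat.rec x0 (fun n x => nxt n x) n
  have hX : ∀ n, P n (X n) := by
    intro n
    induction n with
    | zero => 
      change x0 ∈ Icc (u 0) (u 0 + L / 2 ^ 0) ∧ A x0 ≤ ENNReal.ofReal (4 * M / (L / 2 ^ 0))
      rw [pow_zero, div_one]
      exact ⟨hx0, hAx0⟩
    | succ n ih => exact h1 n _ ih
  have hQ : ∀ n, Q n (X n) (X (n + 1)) := fun n => h2 n _ (hX n)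
  have hlim0 : Filter.Tendsto (fun n : ℕ => L / 2 ^ n) Filter.atTop (nhds 0) := by
    have := (tendsto_pow_atTop_nhds_zero_of_lt_one (r := (1/2:ℝ)) (by norm_num)
      (by norm_num)).const_mul L
    simpa [div_eq_mul_inv] using this
  have hlim : Filter.Tendsto X Filter.atTop (nhds e) := by
    rw [tendsto_iff_dist_tendsto_zero]
    refine squeeze_zero (fun _ => dist_nonneg) (fun n => ?_) hlim0
    have e1 := he n
    have e2 := (hX n).1
    simp only [mem_Icc] at e1 e2
    rw [Real.dist_eq, abs_le]
    constructor <;> linarith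
  have hr : ((1:ℝ) / 2) ^ (α - 1 / p) < 1 := Real.rpow_lt_one (by norm_num) (by norm_num) hγ
  have := dist_le_of_le_geometric_of_tendsto₀ (f := fun n => f (X n)) (((1:ℝ) / 2) ^ (α - 1 / p))
    (((2:ℝ) ^ (α * p + 1) * 32) ^ (1 / p) * M ^ (1 / p) * L ^ (α - 1 / p)) hr (a := f e)
    (by
      intro n
      refine (hQ n).trans (le_of_eq ?_)
      rw [mul_assoc _ (L ^ _)]
      congr 1
      rw [← Real.rpow_natCast (((1:ℝ) / 2) ^ (α - 1 / p)), ← Real.rpow_mul (by norm_num),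
        mul_comm _ (n:ℝ),
        Real.rpow_mul (by norm_num), Real.rpow_natCast,
        ← Real.mul_rpow hL.le (by positivity)]
      congr 1
      simp [div_eq_mul_inv])
    ((hf.tendsto e).comp hlim)
  exact this

theorem grr_main (p α : ℝ) (hp : 0 < p) (hα : 0 < α) (hpα : 1 < p * α)
    (f : ℝ → ℝ) (hf : Continuous f) (M : ℝ) (hM : 0 < M)
    (hB : ∫⁻ x in Icc (0:ℝ) 1, ∫⁻ y in Icc (0:ℝ) 1,
      ENNReal.ofReal (|f x - f y| ^ p / |x - y| ^ (α * p + 1)) ≤ ENNReal.ofReal M)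
    (s t : ℝ) (hs : 0 ≤ s) (hst : s < t) (ht : t ≤ 1) :
    |f s - f t| ≤ 2 * ((2:ℝ) ^ (α * p + 1) * 32) ^ (1 / p) / (1 - (1 / 2) ^ (α - 1 / p))
      * (t - s) ^ (α - 1 / p) * M ^ (1 / p) := by
  have hL : 0 < t - s := sub_pos.2 hst
  have hmeas : Measurable (fun x => ∫⁻ y in Icc (0:ℝ) 1,
      ENNReal.ofReal (|f x - f y| ^ p / |x - y| ^ (α * p + 1))) := by
    apply Measurable.lintegral_prod_right'
      (f := fun z : ℝ × ℝ => ENNReal.ofReal (|f z.1 - f z.2| ^ p / |z.1 - z.2| ^ (α * p + 1)))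
    have := hf.measurable
    fun_prop
  obtain ⟨x0, hx0, hAx0, -⟩ := grr_pick _ _ hmeas hmeas M M hM hM hB hB s (t - s) hL
    (Icc_subset_Icc hs (by linarith))
  have hsm : ∀ n : ℕ, (t - s) / 2 ^ n ≤ t - s := fun n =>
    div_le_self hL.le (one_le_pow₀ (by norm_num))
  have hps : ∀ n : ℕ, 0 < (t - s) / 2 ^ n := fun n => by positivity
  have c1 := grr_chain p α hp hα hpα f hf M (t - s) hM hL _ hmeas (fun _ => rfl) hB
    (fun _ => s) s (fun n => Icc_subset_Icc hs (by linarith [hsm n]))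
    (fun n => ⟨le_rfl, by linarith [hps n]⟩) x0 hx0 hAx0
  have c2 := grr_chain p α hp hα hpα f hf M (t - s) hM hL _ hmeas (fun _ => rfl) hB
    (fun n => t - (t - s) / 2 ^ n) t
    (fun n => Icc_subset_Icc (by linarith [hsm n]) (by linarith))
    (fun n => ⟨by linarith [hps n], by linarith⟩) x0
    (by simp only [mem_Icc, pow_zero, div_one] at hx0 ⊢; constructor <;> linarith) hAx0
  have h3 := abs_sub_le (f s) (f x0) (f t)
  rw [abs_sub_comm (f s) (f x0)] at h3
  refine (h3.trans (add_le_add c1 c2)).trans (le_of_eq ?_)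
  ring

/-- **Sobolev-type embedding from the Garsia–Rodemich–Rumsey inequality.**
For `p > 0`, `α > 0` with `pα > 1` there is a constant `C = C(α, p)` such that for every
continuous `f : [0,1] → ℝ` and `s, t ∈ [0,1]`,
`|f s − f t| ≤ C |t−s|^{α−1/p} (∫₀¹∫₀¹ |f x − f y|^p / |x−y|^{αp+1} dx dy)^{1/p}`,
the inequality being stated in `ℝ≥0∞` so that it is trivially true when the double
integral is infinite. -/
theorem sobolev_embedding_grr (p α : ℝ) (hp : 0 < p) (hα : 0 < α) (hpα : 1 < p * α) :
    ∃ C : ℝ, ∀ f : ℝ → ℝ, ContinuousOn f (Icc 0 1) →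
      ∀ s ∈ Icc (0:ℝ) 1, ∀ t ∈ Icc (0:ℝ) 1,
        ENNReal.ofReal (|f s - f t|) ≤
          ENNReal.ofReal (C * |t - s| ^ (α - 1 / p)) *
            (∫⁻ x in Icc (0:ℝ) 1, ∫⁻ y in Icc (0:ℝ) 1,
                ENNReal.ofReal (|f x - f y| ^ p / |x - y| ^ (α * p + 1))) ^ (1 / p) := by
  have hγ : 0 < α - 1 / p := by
    rw [sub_pos, div_lt_iff₀ hp]; linarith
  have hr : ((1:ℝ) / 2) ^ (α - 1 / p) < 1 := Real.rpow_lt_one (by norm_num) (by norm_num) hγ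
  set C := 2 * ((2:ℝ) ^ (α * p + 1) * 32) ^ (1 / p) / (1 - (1 / 2) ^ (α - 1 / p)) with hC
  have hCpos : 0 < C := div_pos (by positivity) (by linarith)
  refine ⟨C, fun f hf => ?_⟩
  have hord : ∀ s ∈ Icc (0:ℝ) 1, ∀ t ∈ Icc (0:ℝ) 1, s < t →
      ENNReal.ofReal (|f s - f t|) ≤
          ENNReal.ofReal (C * |t - s| ^ (α - 1 / p)) *
            (∫⁻ x in Icc (0:ℝ) 1, ∫⁻ y in Icc (0:ℝ) 1,
                ENNReal.ofReal (|f x - f y| ^ p / |x - y| ^ (α * p + 1))) ^ (1 / p) := by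
    intro s hs t ht hst
    set B := ∫⁻ x in Icc (0:ℝ) 1, ∫⁻ y in Icc (0:ℝ) 1,
                ENNReal.ofReal (|f x - f y| ^ p / |x - y| ^ (α * p + 1)) with hBdef
    have hL : 0 < t - s := sub_pos.2 hst
    rw [abs_of_pos hL]
    have hK : 0 < C * (t - s) ^ (α - 1 / p) := by positivity
    by_cases hB : B = ⊤
    · rw [hB, ENNReal.top_rpow_of_pos (by positivity), ENNReal.mul_top (by simpa using hK)]
      exact le_top
    let F : ℝ → ℝ := IccExtend (zero_le_one (α := ℝ)) ((Icc (0:ℝ) 1).domRestrict f)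
    have hF : Continuous F := (continuousOn_iff_continuous_domRestrict.1 hf).Icc_extend'
    have hFf : ∀ x ∈ Icc (0:ℝ) 1, F x = f x := fun x hx => IccExtend_of_mem _ _ hx
    have hBF : ∫⁻ x in Icc (0:ℝ) 1, ∫⁻ y in Icc (0:ℝ) 1,
        ENNReal.ofReal (|F x - F y| ^ p / |x - y| ^ (α * p + 1)) = B := by
      refine setLIntegral_congr_fun measurableSet_Icc (fun x hx => ?_)
      refine setLIntegral_congr_fun measurableSet_Icc (fun y hy => ?_)
      simp only [hFf x hx, hFf y hy]
    have hall : ∀ M ∈ Ioi B.toReal,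
        |f s - f t| ≤ C * (t - s) ^ (α - 1 / p) * M ^ (1 / p) := by
      intro M hM
      have hM0 : 0 < M := lt_of_le_of_lt ENNReal.toReal_nonneg hM
      have := grr_main p α hp hα hpα F hF M hM0
        (by rw [hBF]; exact (ENNReal.le_ofReal_iff_toReal_le hB hM0.le).2 (le_of_lt hM))
        s t hs.1 hst ht.2
      rwa [hFf s hs, hFf t ht] at this
    have hcont : Continuous (fun M : ℝ => C * (t - s) ^ (α - 1 / p) * M ^ (1 / p)) :=
      continuous_const.mul (Real.continuous_rpow_const (by positivity))
    have hfin : |f s - f t| ≤ C * (t - s) ^ (α - 1 / p) * B.toReal ^ (1 / p) :=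
      ge_of_tendsto ((hcont.tendsto B.toReal).mono_left
        (nhdsWithin_le_nhds (s := Ioi B.toReal)))
        (Filter.eventually_of_mem self_mem_nhdsWithin hall)
    refine (ENNReal.ofReal_le_ofReal hfin).trans ?_
    rw [ENNReal.ofReal_mul hK.le, ← ENNReal.ofReal_rpow_of_nonneg ENNReal.toReal_nonneg
      (by positivity), ENNReal.ofReal_toReal hB]
  intro s hs t ht
  rcases lt_trichotomy s t with h | h | h
  · exact hord s hs t ht h
  · simp [h]
  · rw [abs_sub_comm (f s), abs_sub_comm t]
    exact hord t ht s hs h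
end

section
/- Let n ≥ 1, α > 0, and for 1 ≤ k ≤ n let γ_k > 2/α. Then for every continuous function f : [0,1]^n → ℝ and all s, t ∈ [0,1]^n, |□ⁿ_s f(t)| ≤ 8ⁿ ∏_{k=1}^n [γ_k |t_k − s_k|^{γ_k − 2/α} / (γ_k − 2/α)] · (4ⁿ ∫_{[0,1]^n}∫_{[0,1]^n} |□ⁿ_y f(x)|^α / ∏_{k=1}^n |x_k − y_k|^{αγ_k} dx dy)^{1/α}, where the inequality is trivially true if the double integral is infinite. -/
open MeasureTheory Set

/-- Rectangular increment of `f` on the box determined by `y` and `x`: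
`□_y f(x) = Σ_{S ⊆ ι} (−1)^{|S|} f(z_S)` where `z_S` has `k`-th coordinate `y k`
for `k ∈ S` and `x k` otherwise. -/
def boxIncr {ι : Type*} [Fintype ι] [DecidableEq ι] (f : (ι → ℝ) → ℝ) (y x : ι → ℝ) : ℝ :=
  ∑ S : Finset ι, (-1 : ℝ) ^ S.card * f (fun k => if k ∈ S then y k else x k)

lemma ms_select (J : Set ℝ) (d : ℝ) (hd : 0 < d)
    (hv : volume J = ENNReal.ofReal d) (φ ψ : ℝ → ENNReal) (hφ : Measurable φ) (hψ : Measurable ψ)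
    (b c : ℝ) (hb : 0 < b) (hc : 0 < c) (h1 : ∫⁻ y in J, φ y ≤ ENNReal.ofReal b)
    (h2 : ∫⁻ y in J, ψ y ≤ ENNReal.ofReal c) :
    ∃ y ∈ J, φ y ≤ ENNReal.ofReal (2 * b / d) ∧ ψ y ≤ ENNReal.ofReal (2 * c / d) := by
  have key := exists_le_setLAverage (μ := volume) (s := J)
    (f := fun y => ENNReal.ofReal (1 / (2 * b)) * φ y + ENNReal.ofReal (1 / (2 * c)) * ψ y)
    (by rw [hv]; simpa using hd) (by rw [hv]; simp) (by fun_prop)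
  obtain ⟨y, hy, h⟩ := key
  have hint : ∫⁻ y in J, (ENNReal.ofReal (1 / (2 * b)) * φ y + ENNReal.ofReal (1 / (2 * c)) * ψ y)
      ≤ 1 := by
    rw [lintegral_add_left (by fun_prop), lintegral_const_mul _ hφ, lintegral_const_mul _ hψ]
    calc _ ≤ ENNReal.ofReal (1 / (2 * b)) * ENNReal.ofReal b
          + ENNReal.ofReal (1 / (2 * c)) * ENNReal.ofReal c := by gcongr
      _ = 1 := by
        rw [← ENNReal.ofReal_mul (by positivity), ← ENNReal.ofReal_mul (by positivity),
          ← ENNReal.ofReal_add (by positivity) (by positivity)]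
        rw [← ENNReal.ofReal_one]
        congr 1
        field_simp
        norm_num
  rw [setLAverage_eq, hv] at h
  have h' : ENNReal.ofReal (1 / (2 * b)) * φ y + ENNReal.ofReal (1 / (2 * c)) * ψ y
      ≤ ENNReal.ofReal (1 / d) := by
    refine h.trans ?_
    rw [ENNReal.ofReal_div_of_pos hd, ENNReal.ofReal_one]
    gcongr
  have aux : ∀ (u : ENNReal) (a : ℝ), 0 < a →
      ENNReal.ofReal (1 / (2 * a)) * u ≤ ENNReal.ofReal (1 / d) → u ≤ ENNReal.ofReal (2 * a / d) := by
    intro u a ha hu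
    calc u = ENNReal.ofReal (2 * a) * (ENNReal.ofReal (1 / (2 * a)) * u) := by
            rw [← mul_assoc, ← ENNReal.ofReal_mul (by positivity), mul_one_div_cancel (by positivity)]
            simp
      _ ≤ ENNReal.ofReal (2 * a) * ENNReal.ofReal (1 / d) := by gcongr
      _ = _ := by
        rw [← ENNReal.ofReal_mul (by positivity)]
        congr 1
        field_simp
  exact ⟨y, hy, aux _ _ hb (le_self_add.trans h'), aux _ _ hc (le_add_self.trans h')⟩

lemma ms_arith (α γ b r d : ℝ) (hα : 0 < α) (hγ : 2 / α < γ) (hb : 0 < b) (hr : 0 < r)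
    (hd : d = 2 ^ (-(1 / γ)) * r) :
    (4 * b / (d * d) * r ^ (α * γ)) ^ (1 / α) ≤
      4 * γ / (γ - 2 / α) * (4 * b) ^ (1 / α) * (r ^ (γ - 2 / α) - d ^ (γ - 2 / α)) := by
  have hγ0 : 0 < γ := lt_trans (by positivity) hγ
  have hd0 : 0 < d := by rw [hd]; positivity
  have hr' : r = 2 ^ (1 / γ) * d := by
    rw [hd, ← mul_assoc, ← Real.rpow_add (by norm_num)]; simp
  set β := γ - 2 / α with hβ
  have hβ0 : 0 < β := by rw [hβ]; linarith
  have e1 : (4 * b / (d * d) * r ^ (α * γ)) ^ (1 / α) = 2 * (4 * b) ^ (1 / α) * d ^ β := by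
    rw [Real.mul_rpow (by positivity) (by positivity), Real.div_rpow (by positivity) (by positivity),
      ← Real.rpow_mul hr.le, show α * γ * (1 / α) = γ by field_simp]
    have : r ^ γ = 2 * d ^ γ := by
      rw [hr', Real.mul_rpow (by positivity) hd0.le, ← Real.rpow_mul (by norm_num)]
      rw [one_div_mul_cancel hγ0.ne', Real.rpow_one]
    rw [this, hβ, Real.rpow_sub hd0]
    have : (d * d) ^ (1 / α) = d ^ (2 / α) := by
      rw [← pow_two, ← Real.rpow_natCast, ← Real.rpow_mul hd0.le]; congr 1; push_cast; ring
    rw [this]; ring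
  have e2 : r ^ β = 2 ^ (β / γ) * d ^ β := by
    rw [hr', Real.mul_rpow (by positivity) hd0.le, ← Real.rpow_mul (by norm_num)]
    congr 2; ring
  have e3 : 1 + β / γ / 2 ≤ (2 : ℝ) ^ (β / γ) := by
    rw [Real.rpow_def_of_pos (by norm_num)]
    have := Real.add_one_le_exp (Real.log 2 * (β / γ))
    have h2 := Real.log_two_gt_d9
    have h3 : 0 < β / γ := by positivity
    nlinarith
  rw [e1, e2]
  have : 2 ≤ 4 * γ / β * (2 ^ (β / γ) - 1) := by
    calc (2 : ℝ) = 4 * γ / β * (β / γ / 2) := by field_simp; norm_num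
      _ ≤ _ := by gcongr; linarith
  calc _ ≤ (4 * γ / β * (2 ^ (β / γ) - 1)) * (4 * b) ^ (1 / α) * d ^ β := by gcongr
    _ = _ := by ring

lemma ms_ker_bound (α γ c r : ℝ) (hα : 0 < α) (hγ : 0 < γ) (hc : 0 ≤ c) (f : ℝ → ℝ) (x y : ℝ)
    (hxy : |x - y| ≤ r)
    (h : ENNReal.ofReal (|f x - f y| ^ α / |x - y| ^ (α * γ)) ≤ ENNReal.ofReal c) :
    |f x - f y| ≤ (c * r ^ (α * γ)) ^ (1 / α) := by
  have hr : 0 ≤ r := (abs_nonneg _).trans hxy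
  rcases eq_or_ne x y with rfl | hne
  · simp; positivity
  have hp : 0 < |x - y| := abs_pos.2 (sub_ne_zero.2 hne)
  rw [ENNReal.ofReal_le_ofReal_iff hc, div_le_iff₀ (by positivity)] at h
  have h2 : |f x - f y| ^ α ≤ c * r ^ (α * γ) := h.trans (by gcongr)
  have h3 := Real.rpow_le_rpow (by positivity) h2 (show 0 ≤ 1 / α by positivity)
  rwa [← Real.rpow_mul (abs_nonneg _), mul_one_div_cancel hα.ne', Real.rpow_one] at h3

set_option maxHeartbeats 1000000 in
lemma ms_step (α γ : ℝ) (hα : 0 < α) (hγ : 2 / α < γ) (f : ℝ → ℝ) (hf : Continuous f)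
    (s t e : ℝ) (he : e = s ∨ e = t) (b : ℝ) (hb : 0 < b)
    (hB : ∫⁻ x in Icc s t, ∫⁻ y in Icc s t,
      ENNReal.ofReal (|f x - f y| ^ α / |x - y| ^ (α * γ)) ≤ ENNReal.ofReal b)
    (x : ℝ) (hx : x ∈ Ioo s t)
    (hI : ∫⁻ y in Icc s t, ENNReal.ofReal (|f x - f y| ^ α / |x - y| ^ (α * γ))
      ≤ ENNReal.ofReal (2 * b / |x - e|)) :
    ∃ y ∈ Ioo s t, |y - e| ≤ 2 ^ (-(1 / γ)) * |x - e| ∧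
      (∫⁻ z in Icc s t, ENNReal.ofReal (|f y - f z| ^ α / |y - z| ^ (α * γ))
        ≤ ENNReal.ofReal (2 * b / |y - e|)) ∧
      |f x - f y| ≤ 4 * γ / (γ - 2 / α) * (4 * b) ^ (1 / α) *
        (|x - e| ^ (γ - 2 / α) - |y - e| ^ (γ - 2 / α)) := by
  obtain ⟨hx1, hx2⟩ := hx
  have hγ0 : 0 < γ := lt_trans (by positivity) hγ
  have hβ0 : 0 < γ - 2 / α := by linarith
  have hq : (2 : ℝ) ^ (-(1 / γ)) ≤ 1 :=
    Real.rpow_le_one_of_one_le_of_nonpos (by norm_num) (by simp; positivity)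
  set r := |x - e| with hr
  have hr0 : 0 < r := by
    rw [hr, abs_pos]; rcases he with rfl | rfl <;> [exact (sub_pos.2 hx1).ne'; exact (sub_neg.2 hx2).ne]
  set d := (2 : ℝ) ^ (-(1 / γ)) * r with hd
  have hd0 : 0 < d := by positivity
  have hdr : d ≤ r := by rw [hd]; nlinarith
  have hmeas : Measurable (Function.uncurry fun x y : ℝ =>
      ENNReal.ofReal (|f x - f y| ^ α / |x - y| ^ (α * γ))) := by
    have := hf.measurable
    unfold Function.uncurry
    fun_prop
  obtain ⟨J, hJv, hJsub, hJe⟩ : ∃ J : Set ℝ, volume J = ENNReal.ofReal d ∧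
      J ⊆ Ioo s t ∧ ∀ y ∈ J, 0 < |y - e| ∧ |y - e| ≤ d ∧ |x - y| ≤ r := by
    rcases he with rfl | rfl
    · have hr2 : r = x - e := by rw [hr, abs_of_pos (by linarith)]
      refine ⟨Ioo e (e + d), by simp, ?_, ?_⟩
      · intro y hy; exact ⟨hy.1, by linarith [hy.2]⟩
      · intro y hy
        have := hy.1; have := hy.2
        rw [abs_of_pos (by linarith)]
        refine ⟨by linarith, by linarith, abs_le.2 ⟨by linarith, by linarith⟩⟩
    · have hr2 : r = e - x := by rw [hr, abs_sub_comm, abs_of_pos (by linarith)]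
      refine ⟨Ioo (e - d) e, by simp, ?_, ?_⟩
      · intro y hy; exact ⟨by linarith [hy.1], hy.2⟩
      · intro y hy
        have := hy.1; have := hy.2
        rw [abs_sub_comm y, abs_of_pos (by linarith)]
        refine ⟨by linarith, by linarith, abs_le.2 ⟨by linarith, by linarith⟩⟩
  have hsub := hJsub.trans Ioo_subset_Icc_self
  obtain ⟨y, hy, hy1, hy2⟩ := ms_select J d hd0 hJv
    (fun x => ∫⁻ y in Icc s t, ENNReal.ofReal (|f x - f y| ^ α / |x - y| ^ (α * γ)))
    (fun y => ENNReal.ofReal (|f x - f y| ^ α / |x - y| ^ (α * γ)))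
    hmeas.lintegral_prod_right (hmeas.comp measurable_prodMk_left) b (2 * b / r) hb (by positivity)
    ((lintegral_mono_set hsub).trans hB) ((lintegral_mono_set hsub).trans hI)
  obtain ⟨hy3, hy4, hy5⟩ := hJe y hy
  refine ⟨y, hJsub hy, hy4, hy1.trans (ENNReal.ofReal_le_ofReal (by gcongr)), ?_⟩
  have h6 := ms_ker_bound α γ (4 * b / (d * d)) r hα hγ0 (by positivity) f x y hy5
    (hy2.trans (ENNReal.ofReal_le_ofReal (by
      calc 2 * (2 * b / r) / d = 4 * b / (r * d) := by field_simp; norm_num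
        _ ≤ _ := by gcongr)))
  refine h6.trans ((ms_arith α γ b r d hα hγ hb hr0 hd).trans ?_)
  gcongr

lemma ms_half (α γ : ℝ) (hα : 0 < α) (hγ : 2 / α < γ) (f : ℝ → ℝ) (hf : Continuous f)
    (s t e : ℝ) (he : e = s ∨ e = t) (b : ℝ) (hb : 0 < b)
    (hB : ∫⁻ x in Icc s t, ∫⁻ y in Icc s t,
      ENNReal.ofReal (|f x - f y| ^ α / |x - y| ^ (α * γ)) ≤ ENNReal.ofReal b)
    (x : ℝ) (hx : x ∈ Ioo s t)
    (hI : ∫⁻ y in Icc s t, ENNReal.ofReal (|f x - f y| ^ α / |x - y| ^ (α * γ))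
      ≤ ENNReal.ofReal (2 * b / |x - e|)) :
    |f x - f e| ≤ 4 * γ / (γ - 2 / α) * (4 * b) ^ (1 / α) * |x - e| ^ (γ - 2 / α) := by
  have hγ0 : 0 < γ := lt_trans (by positivity) hγ
  have hβ0 : 0 < γ - 2 / α := by linarith
  have hchain : ∀ n : ℕ, ∃ y ∈ Ioo s t, |y - e| ≤ (2 ^ (-(1 / γ))) ^ n * |x - e| ∧
      (∫⁻ z in Icc s t, ENNReal.ofReal (|f y - f z| ^ α / |y - z| ^ (α * γ))
        ≤ ENNReal.ofReal (2 * b / |y - e|)) ∧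
      |f x - f y| ≤ 4 * γ / (γ - 2 / α) * (4 * b) ^ (1 / α) *
        (|x - e| ^ (γ - 2 / α) - |y - e| ^ (γ - 2 / α)) := by
    intro n
    induction n with
    | zero => exact ⟨x, hx, by simp, hI, by simp⟩
    | succ n ih =>
      obtain ⟨y, hy, h1, h2, h3⟩ := ih
      obtain ⟨z, hz, k1, k2, k3⟩ := ms_step α γ hα hγ f hf s t e he b hb hB y hy h2
      refine ⟨z, hz, k1.trans ?_, k2, ?_⟩
      · rw [pow_succ', mul_assoc]; gcongr
      · have := abs_sub_le (f x) (f y) (f z)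
        linarith
  choose y hy h1 h2 h3 using hchain
  have hq : (2 : ℝ) ^ (-(1 / γ)) < 1 :=
    Real.rpow_lt_one_of_one_lt_of_neg (by norm_num) (by simp; positivity)
  have hlim : Filter.Tendsto y Filter.atTop (nhds e) := by
    rw [tendsto_iff_dist_tendsto_zero]
    refine squeeze_zero (fun _ => dist_nonneg) (fun n => h1 n) ?_
    simpa using (tendsto_pow_atTop_nhds_zero_of_lt_one (by positivity) hq).mul_const |x - e|
  have hl2 : Filter.Tendsto (fun n => |f x - f (y n)|) Filter.atTop (nhds |f x - f e|) :=
    (((hf.tendsto e).comp hlim).const_sub (f x)).abs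
  refine le_of_tendsto' hl2 (fun n => (h3 n).trans ?_)
  have : 0 ≤ |y n - e| ^ (γ - 2 / α) := by positivity
  gcongr
  linarith

lemma ms_one_real (α γ : ℝ) (hα : 0 < α) (hγ : 2 / α < γ) (f : ℝ → ℝ) (hf : Continuous f)
    (s t : ℝ) (hst : s < t) (b : ℝ) (hb : 0 < b)
    (hB : ∫⁻ x in Icc s t, ∫⁻ y in Icc s t,
      ENNReal.ofReal (|f x - f y| ^ α / |x - y| ^ (α * γ)) ≤ ENNReal.ofReal b) :
    |f t - f s| ≤ 8 * (γ * |t - s| ^ (γ - 2 / α) / (γ - 2 / α)) * (4 * b) ^ (1 / α) := by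
  have hγ0 : 0 < γ := lt_trans (by positivity) hγ
  have hβ0 : 0 < γ - 2 / α := by linarith
  have hmeas : Measurable (Function.uncurry fun x y : ℝ =>
      ENNReal.ofReal (|f x - f y| ^ α / |x - y| ^ (α * γ))) := by
    have := hf.measurable
    unfold Function.uncurry
    fun_prop
  have hmI := hmeas.lintegral_prod_right (ν := volume.restrict (Icc s t))
  have h0 := (lintegral_mono_set Ioo_subset_Icc_self).trans hB
  obtain ⟨x, hx, hI, -⟩ := ms_select (Ioo s t) (t - s) (sub_pos.2 hst) (by simp)
    _ _ hmI hmI b b hb hb h0 h0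
  have hx1 := hx.1
  have hx2 := hx.2
  have key : ∀ e, (e = s ∨ e = t) → |f x - f e| ≤
      4 * γ / (γ - 2 / α) * (4 * b) ^ (1 / α) * |t - s| ^ (γ - 2 / α) := by
    intro e he
    have hle : |x - e| ≤ t - s := by
      rcases he with rfl | rfl <;> rw [abs_le] <;> constructor <;> linarith
    have hpos : 0 < |x - e| := by
      rw [abs_pos]; rcases he with rfl | rfl <;> [exact (sub_pos.2 hx1).ne'; exact (sub_neg.2 hx2).ne]
    refine (ms_half α γ hα hγ f hf s t e he b hb hB x hx
      (hI.trans (ENNReal.ofReal_le_ofReal (by gcongr)))).trans ?_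
    rw [abs_of_pos (sub_pos.2 hst)]
    gcongr
  have k1 := key s (Or.inl rfl)
  have k2 := key t (Or.inr rfl)
  have k3 := abs_sub_le (f t) (f x) (f s)
  rw [abs_sub_comm (f t) (f x)] at k3
  calc _ ≤ _ := k3
    _ ≤ _ := add_le_add k2 k1
    _ = _ := by ring

lemma ms_one (α γ : ℝ) (hα : 0 < α) (hγ : 2 / α < γ) (f : ℝ → ℝ) (hf : Continuous f)
    (s t : ℝ) (hs : s ∈ Icc (0 : ℝ) 1) (ht : t ∈ Icc (0 : ℝ) 1) :
    ENNReal.ofReal (|f t - f s|) ^ α ≤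
      ENNReal.ofReal (8 * (γ * |t - s| ^ (γ - 2 / α) / (γ - 2 / α))) ^ α *
        (4 * ∫⁻ x in Icc (0 : ℝ) 1, ∫⁻ y in Icc (0 : ℝ) 1,
          ENNReal.ofReal (|f x - f y| ^ α / |x - y| ^ (α * γ))) := by
  have hγ0 : 0 < γ := lt_trans (by positivity) hγ
  have hβ0 : 0 < γ - 2 / α := by linarith
  wlog hst : s ≤ t generalizing s t
  · have := this t s ht hs (le_of_not_ge hst)
    rwa [abs_sub_comm (f t), abs_sub_comm t]
  rcases hst.eq_or_lt with rfl | hst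
  · simp [ENNReal.zero_rpow_of_pos hα]
  set B := ∫⁻ x in Icc (0 : ℝ) 1, ∫⁻ y in Icc (0 : ℝ) 1,
          ENNReal.ofReal (|f x - f y| ^ α / |x - y| ^ (α * γ)) with hBdef
  have hD : 0 < 8 * (γ * |t - s| ^ (γ - 2 / α) / (γ - 2 / α)) := by
    have : 0 < |t - s| := abs_pos.2 (sub_pos.2 hst).ne'
    positivity
  rcases eq_or_ne B ⊤ with hB | hB
  · rw [hB, ENNReal.mul_top (by norm_num), ENNReal.mul_top]
    · exact le_top
    · simp [ENNReal.rpow_eq_zero_iff, hα, hα.not_gt]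
      linarith
  set D := 8 * (γ * |t - s| ^ (γ - 2 / α) / (γ - 2 / α)) with hDdef
  have hsub : Icc s t ⊆ Icc 0 1 := Icc_subset_Icc hs.1 ht.2
  have hBst : ∫⁻ x in Icc s t, ∫⁻ y in Icc s t,
      ENNReal.ofReal (|f x - f y| ^ α / |x - y| ^ (α * γ)) ≤ B :=
    (lintegral_mono_set hsub).trans (lintegral_mono fun x => lintegral_mono_set hsub)
  have hreal : |f t - f s| ≤ D * (4 * B.toReal) ^ (1 / α) := by
    have hall : ∀ b > B.toReal, |f t - f s| ≤ D * (4 * b) ^ (1 / α) := by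
      intro b hb
      refine ms_one_real α γ hα hγ f hf s t hst b (ENNReal.toReal_nonneg.trans_lt hb) ?_
      refine hBst.trans ?_
      rw [← ENNReal.ofReal_toReal hB]
      exact ENNReal.ofReal_le_ofReal hb.le
    have hc : Continuous fun b : ℝ => D * (4 * b) ^ (1 / α) := by
      have h1α : 0 ≤ 1 / α := by positivity
      exact continuous_const.mul
        ((Real.continuous_rpow_const h1α).comp (continuous_const.mul continuous_id))
    exact ge_of_tendsto ((hc.tendsto B.toReal).mono_left nhdsWithin_le_nhds)
      (Filter.eventually_of_mem (self_mem_nhdsWithin (s := Ioi B.toReal)) hall)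
  rw [← ENNReal.ofReal_toReal hB, ENNReal.ofReal_rpow_of_nonneg (abs_nonneg _) hα.le,
    ENNReal.ofReal_rpow_of_nonneg hD.le hα.le, show (4 : ENNReal) = ENNReal.ofReal 4 by simp,
    ← ENNReal.ofReal_mul (by norm_num), ← ENNReal.ofReal_mul (by positivity)]
  refine ENNReal.ofReal_le_ofReal ?_
  refine (Real.rpow_le_rpow (abs_nonneg _) hreal hα.le).trans ?_
  have : 0 ≤ B.toReal := ENNReal.toReal_nonneg
  rw [Real.mul_rpow hD.le (by positivity), ← Real.rpow_mul (by positivity),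
    one_div_mul_cancel hα.ne', Real.rpow_one]

lemma ms_boxIncr_cons {n : ℕ} (f : (Fin (n + 1) → ℝ) → ℝ) (y0 x0 : ℝ) (y x : Fin n → ℝ) :
    boxIncr f (Fin.cons y0 y) (Fin.cons x0 x) =
      boxIncr (fun z => f (Fin.cons x0 z)) y x - boxIncr (fun z => f (Fin.cons y0 z)) y x := by
  unfold boxIncr
  have hu : (Finset.univ : Finset (Finset (Fin (n + 1)))) =
      (insert 0 (Finset.univ.image Fin.succ)).powerset := by
    rw [← Finset.powerset_univ]
    congr 1
    ext i
    refine Fin.cases ?_ (fun j => ?_) i <;> simp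
  rw [hu, Finset.sum_powerset_insert (by simp), Finset.powerset_image,
    Finset.sum_image (by
      intro a _ b _ h
      exact Finset.image_injective (Fin.succ_injective n) h),
    Finset.sum_image (by
      intro a _ b _ h
      exact Finset.image_injective (Fin.succ_injective n) h), Finset.powerset_univ, sub_eq_add_neg, ← Finset.sum_neg_distrib]
  congr 1
  · refine Finset.sum_congr rfl fun S _ => ?_
    rw [Finset.card_image_of_injective _ (Fin.succ_injective n)]
    congr 2
    ext k
    refine Fin.cases ?_ (fun j => ?_) k <;> simp
  · refine Finset.sum_congr rfl fun S _ => ?_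
    rw [Finset.card_insert_of_notMem (by simp),
      Finset.card_image_of_injective _ (Fin.succ_injective n), pow_succ]
    rw [mul_neg_one, neg_mul]
    congr 3
    ext k
    refine Fin.cases ?_ (fun j => ?_) k <;> simp

lemma ms_boxIncr_sub {n : ℕ} (f g : (Fin n → ℝ) → ℝ) (y x : Fin n → ℝ) :
    boxIncr (fun z => f z - g z) y x = boxIncr f y x - boxIncr g y x := by
  unfold boxIncr
  rw [← Finset.sum_sub_distrib]
  exact Finset.sum_congr rfl fun S _ => by ring

lemma ms_boxIncr_continuous {X : Type*} [TopologicalSpace X] {n : ℕ} (f : X → (Fin n → ℝ) → ℝ)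
    (hf : Continuous fun p : X × (Fin n → ℝ) => f p.1 p.2) (y x : X → Fin n → ℝ)
    (hy : Continuous y) (hx : Continuous x) :
    Continuous fun u => boxIncr (f u) (y u) (x u) := by
  unfold boxIncr
  refine continuous_finsetSum _ fun S _ => continuous_const.mul ?_
  have hz : Continuous fun u => (fun k => if k ∈ S then y u k else x u k : Fin n → ℝ) := by
    refine continuous_pi fun k => ?_
    by_cases hk : k ∈ S
    · simp only [hk, if_true]; fun_prop
    · simp only [hk, if_false]; fun_prop
  exact hf.comp (continuous_id.prodMk hz)

lemma ms_lintegral_cons {n : ℕ} (F : (Fin (n + 1) → ℝ) → ENNReal) (hF : Measurable F) :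
    ∫⁻ x in Icc (0 : Fin (n + 1) → ℝ) 1, F x =
      ∫⁻ x0 in Icc (0 : ℝ) 1, ∫⁻ x in Icc (0 : Fin n → ℝ) 1, F (Fin.cons x0 x) := by
  have hp := (volume_preserving_piFinSuccAbove (fun _ : Fin (n + 1) => ℝ) 0).symm
  have hpre : (MeasurableEquiv.piFinSuccAbove (fun _ : Fin (n + 1) => ℝ) 0).symm ⁻¹'
      (Icc (0 : Fin (n + 1) → ℝ) 1) = Icc (0 : ℝ) 1 ×ˢ Icc (0 : Fin n → ℝ) 1 := by
    ext ⟨a, b⟩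
    simp [MeasurableEquiv.piFinSuccAbove, Pi.le_def, Fin.forall_fin_succ, Fin.insertNthEquiv]
  rw [← hp.setLIntegral_comp_preimage measurableSet_Icc hF, hpre]
  rw [Measure.volume_eq_prod, ← Measure.prod_restrict, lintegral_prod]
  · refine lintegral_congr fun a => lintegral_congr fun b => ?_
    simp [MeasurableEquiv.piFinSuccAbove, Fin.insertNthEquiv]
  · exact (hF.comp (MeasurableEquiv.measurable _)).aemeasurable

lemma ms_swap {n : ℕ} (G : (Fin (n + 1) → ℝ) → (Fin (n + 1) → ℝ) → ENNReal)
    (hG : Measurable (Function.uncurry G)) :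
    ∫⁻ x in Icc (0 : Fin (n + 1) → ℝ) 1, ∫⁻ y in Icc (0 : Fin (n + 1) → ℝ) 1, G x y =
      ∫⁻ x0 in Icc (0 : ℝ) 1, ∫⁻ y0 in Icc (0 : ℝ) 1, ∫⁻ x in Icc (0 : Fin n → ℝ) 1,
        ∫⁻ y in Icc (0 : Fin n → ℝ) 1, G (Fin.cons x0 x) (Fin.cons y0 y) := by
  rw [ms_lintegral_cons _ hG.lintegral_prod_right]
  refine lintegral_congr fun x0 => ?_
  have e1 : ∀ x : Fin n → ℝ, ∫⁻ y in Icc (0 : Fin (n + 1) → ℝ) 1, G (Fin.cons x0 x) y =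
      ∫⁻ y0 in Icc (0 : ℝ) 1, ∫⁻ y in Icc (0 : Fin n → ℝ) 1,
        G (Fin.cons x0 x) (Fin.cons y0 y) := fun x =>
    ms_lintegral_cons _ (hG.comp measurable_prodMk_left)
  simp_rw [e1]
  refine lintegral_lintegral_swap (Measurable.aemeasurable ?_)
  have hc : Measurable fun q : ((Fin n → ℝ) × ℝ) × (Fin n → ℝ) =>
      ((Fin.cons x0 q.1.1 : Fin (n + 1) → ℝ), (Fin.cons q.1.2 q.2 : Fin (n + 1) → ℝ)) := by
    apply Continuous.measurable
    fun_prop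
  exact Measurable.lintegral_prod_right' (hG.comp hc)

set_option maxHeartbeats 1000000 in
lemma ms_multi (α : ℝ) (hα : 0 < α) : ∀ (n : ℕ) (γ : Fin n → ℝ) (_ : ∀ k, 2 / α < γ k)
    (f : (Fin n → ℝ) → ℝ) (_ : Continuous f) (s : Fin n → ℝ) (_ : s ∈ Icc (0 : Fin n → ℝ) 1)
    (t : Fin n → ℝ) (_ : t ∈ Icc (0 : Fin n → ℝ) 1),
      ENNReal.ofReal (|boxIncr f s t|) ^ α ≤
        ENNReal.ofReal (8 ^ n * ∏ k, γ k * |t k - s k| ^ (γ k - 2 / α) / (γ k - 2 / α)) ^ α *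
          (4 ^ n * ∫⁻ x in Icc (0 : Fin n → ℝ) 1, ∫⁻ y in Icc (0 : Fin n → ℝ) 1,
                ENNReal.ofReal
                  (|boxIncr f y x| ^ α / ∏ k, |x k - y k| ^ (α * γ k))) := by
  intro n
  induction n with
  | zero =>
    intro γ hγ f hf s hs t ht
    have hI : Icc (0 : Fin 0 → ℝ) 1 = univ := by
      ext x; simp [Subsingleton.elim x 0]
    simp only [hI, Measure.restrict_univ, Measure.volume_pi_eq_dirac 0, lintegral_dirac]
    have hb : ∀ y x : Fin 0 → ℝ, boxIncr f y x = f 0 := by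
      intro y x
      unfold boxIncr
      simp only [Finset.univ_unique, Finset.sum_singleton]
      rw [Subsingleton.elim (fun k : Fin 0 => _) (0 : Fin 0 → ℝ),
        Subsingleton.elim (default : Finset (Fin 0)) ∅]
      simp
    simp [hb, ENNReal.ofReal_rpow_of_nonneg, hα.le]
  | succ n ih =>
    intro γ hγ f hf s hs t ht
    have hcube : ∀ u ∈ Icc (0 : Fin (n + 1) → ℝ) 1,
        u 0 ∈ Icc (0 : ℝ) 1 ∧ Fin.tail u ∈ Icc (0 : Fin n → ℝ) 1 := by
      intro u hu
      exact ⟨⟨hu.1 0, hu.2 0⟩, ⟨fun i => hu.1 i.succ, fun i => hu.2 i.succ⟩⟩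
    obtain ⟨hs0, hs'⟩ := hcube s hs
    obtain ⟨ht0, ht'⟩ := hcube t ht
    have hconsc : Continuous fun p : ℝ × (Fin n → ℝ) => f (Fin.cons p.1 p.2) := by fun_prop
    set h : ℝ → ℝ := fun u => boxIncr (fun z => f (Fin.cons u z)) (Fin.tail s) (Fin.tail t) with hh
    have hcont : Continuous h :=
      ms_boxIncr_continuous (fun u z => f (Fin.cons u z)) hconsc _ _ continuous_const continuous_const
    have hst : boxIncr f s t = h (t 0) - h (s 0) := by
      rw [hh]
      simp only
      rw [← ms_boxIncr_cons, Fin.cons_self_tail, Fin.cons_self_tail]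
    have h1 := ms_one α (γ 0) hα (hγ 0) h hcont (s 0) (t 0) hs0 ht0
    have hd : 0 < γ 0 - 2 / α := by linarith [hγ 0]
    set D : ℝ := 8 ^ n * ∏ k : Fin n, γ k.succ * |t k.succ - s k.succ| ^ (γ k.succ - 2 / α)
      / (γ k.succ - 2 / α) with hD
    have hFm : Measurable fun p : (Fin (n + 1) → ℝ) × (Fin (n + 1) → ℝ) => ENNReal.ofReal
        (|boxIncr f p.2 p.1| ^ α / ∏ k, |p.1 k - p.2 k| ^ (α * γ k)) := by
      have : Measurable fun p : (Fin (n + 1) → ℝ) × (Fin (n + 1) → ℝ) => boxIncr f p.2 p.1 :=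
        (ms_boxIncr_continuous (fun _ => f) (by fun_prop) _ _ continuous_snd
          continuous_fst).measurable
      fun_prop
    have hswap : ∫⁻ x in Icc (0 : Fin (n + 1) → ℝ) 1, ∫⁻ y in Icc (0 : Fin (n + 1) → ℝ) 1,
          ENNReal.ofReal (|boxIncr f y x| ^ α / ∏ k, |x k - y k| ^ (α * γ k)) =
        ∫⁻ x0 in Icc (0 : ℝ) 1, ∫⁻ y0 in Icc (0 : ℝ) 1, ∫⁻ x in Icc (0 : Fin n → ℝ) 1,
          ∫⁻ y in Icc (0 : Fin n → ℝ) 1,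
          ENNReal.ofReal (|boxIncr f (Fin.cons y0 y) (Fin.cons x0 x)| ^ α /
            ∏ k, |(Fin.cons x0 x : Fin (n + 1) → ℝ) k - (Fin.cons y0 y : Fin (n + 1) → ℝ) k|
              ^ (α * γ k)) := by
      exact ms_swap (fun x y => ENNReal.ofReal
        (|boxIncr f y x| ^ α / ∏ k, |x k - y k| ^ (α * γ k))) hFm
    have hinner : ∀ x0 y0 : ℝ, ENNReal.ofReal (|h x0 - h y0| ^ α / |x0 - y0| ^ (α * γ 0)) ≤
        ENNReal.ofReal D ^ α * (4 ^ n * ∫⁻ x in Icc (0 : Fin n → ℝ) 1,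
          ∫⁻ y in Icc (0 : Fin n → ℝ) 1,
          ENNReal.ofReal (|boxIncr f (Fin.cons y0 y) (Fin.cons x0 x)| ^ α /
            ∏ k, |(Fin.cons x0 x : Fin (n + 1) → ℝ) k - (Fin.cons y0 y : Fin (n + 1) → ℝ) k|
              ^ (α * γ k))) := by
      intro x0 y0
      have hg := ih (fun k => γ k.succ) (fun k => hγ k.succ)
        (fun z => f (Fin.cons x0 z) - f (Fin.cons y0 z)) (by fun_prop) (Fin.tail s) hs'
        (Fin.tail t) ht'
      rw [ms_boxIncr_sub] at hg
      have hcn : 0 ≤ (|x0 - y0| ^ (α * γ 0))⁻¹ := by positivity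
      have e2 : ∀ x y : Fin n → ℝ, ENNReal.ofReal (|boxIncr f (Fin.cons y0 y) (Fin.cons x0 x)| ^ α /
            ∏ k, |(Fin.cons x0 x : Fin (n + 1) → ℝ) k - (Fin.cons y0 y : Fin (n + 1) → ℝ) k|
              ^ (α * γ k)) = ENNReal.ofReal (|x0 - y0| ^ (α * γ 0))⁻¹ *
            ENNReal.ofReal (|boxIncr (fun z => f (Fin.cons x0 z) - f (Fin.cons y0 z)) y x| ^ α /
            ∏ k : Fin n, |x k - y k| ^ (α * γ k.succ)) := by
        intro x y
        rw [← ENNReal.ofReal_mul hcn, ms_boxIncr_cons, ms_boxIncr_sub, Fin.prod_univ_succ]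
        simp only [Fin.cons_zero, Fin.cons_succ]
        congr 1
        rw [div_eq_mul_inv, div_eq_mul_inv, mul_inv]
        ring
      simp_rw [e2]
      have e3 : ∀ x : Fin n → ℝ, _ := fun x => lintegral_const_mul' (μ := volume.restrict (Icc (0 : Fin n → ℝ) 1)) (ENNReal.ofReal (|x0 - y0| ^ (α * γ 0))⁻¹)
        (fun y => ENNReal.ofReal (|boxIncr (fun z => f (Fin.cons x0 z) - f (Fin.cons y0 z)) y x| ^ α /
            ∏ k : Fin n, |x k - y k| ^ (α * γ k.succ))) ENNReal.ofReal_ne_top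
      simp_rw [e3]
      rw [lintegral_const_mul' _ _ ENNReal.ofReal_ne_top]
      rw [div_eq_inv_mul, ENNReal.ofReal_mul hcn]
      change ENNReal.ofReal |h x0 - h y0| ^ α ≤ ENNReal.ofReal D ^ α * _ at hg
      rw [← ENNReal.ofReal_rpow_of_nonneg (abs_nonneg _) hα.le]
      refine (mul_le_mul' le_rfl hg).trans (le_of_eq ?_)
      ring
    rw [hst, hswap]
    refine h1.trans ?_
    refine (mul_le_mul' le_rfl (mul_le_mul' le_rfl
      (lintegral_mono fun x0 => lintegral_mono fun y0 => hinner x0 y0))).trans (le_of_eq ?_)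
    have hk : ENNReal.ofReal D ^ α ≠ ⊤ := ENNReal.rpow_ne_top_of_nonneg hα.le ENNReal.ofReal_ne_top
    have hk4 : (4 : ENNReal) ^ n ≠ ⊤ := by simp
    have hγ0 : 0 < γ 0 := lt_trans (by positivity) (hγ 0)
    simp_rw [lintegral_const_mul' _ _ hk, lintegral_const_mul' _ _ hk4]
    rw [Fin.prod_univ_succ, show (8 : ℝ) ^ (n + 1) * _ =
      (8 * (γ 0 * |t 0 - s 0| ^ (γ 0 - 2 / α) / (γ 0 - 2 / α))) * D by rw [hD]; ring,
      ENNReal.ofReal_mul (q := D) (by positivity), ENNReal.mul_rpow_of_nonneg _ _ hα.le]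
    ring

/-- **Multiparameter Sobolev-type inequality** obtained from the multiparameter
Garsia–Rodemich–Rumsey inequality with `Ψ(u) = |u|^α` and `p_k(u) = |u|^{γ_k}`:
for `α > 0`, `γ_k > 2/α`, any continuous `f` on `[0,1]^n`, and all `s, t ∈ [0,1]^n`,
`|□ⁿ_s f(t)| ≤ 8ⁿ ∏_k [γ_k |t_k−s_k|^{γ_k−2/α}/(γ_k−2/α)] ·
(4ⁿ ∫∫ |□ⁿ_y f(x)|^α / ∏_k |x_k−y_k|^{αγ_k} dx dy)^{1/α}`, stated in `ℝ≥0∞` so that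
it holds trivially when the double integral is infinite. -/
theorem multiparameter_sobolev (n : ℕ) (hn : 1 ≤ n) (α : ℝ) (hα : 0 < α)
    (γ : Fin n → ℝ) (hγ : ∀ k, 2 / α < γ k)
    (f : (Fin n → ℝ) → ℝ) (hf : ContinuousOn f (Icc 0 1)) :
    ∀ s ∈ Icc (0 : Fin n → ℝ) 1, ∀ t ∈ Icc (0 : Fin n → ℝ) 1,
      ENNReal.ofReal (|boxIncr f s t|) ≤
        ENNReal.ofReal
            (8 ^ n * ∏ k, γ k * |t k - s k| ^ (γ k - 2 / α) / (γ k - 2 / α)) *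
          (ENNReal.ofReal (4 ^ n) *
              ∫⁻ x in Icc (0 : Fin n → ℝ) 1, ∫⁻ y in Icc (0 : Fin n → ℝ) 1,
                ENNReal.ofReal
                  (|boxIncr f y x| ^ α / ∏ k, |x k - y k| ^ (α * γ k))) ^ (1 / α) := by
  intro s hs t ht
  set g : (Fin n → ℝ) → ℝ := fun z => f (fun k => max 0 (min (z k) 1)) with hg
  have hgc : Continuous g := by
    refine hf.comp_continuous (by fun_prop) fun z => ⟨fun k => ?_, fun k => ?_⟩
    · exact le_max_left _ _
    · exact max_le zero_le_one (min_le_right _ _)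
  have hgf : ∀ z ∈ Icc (0 : Fin n → ℝ) 1, g z = f z := by
    intro z hz
    rw [hg]
    simp only
    congr 1
    ext k
    have h0 : 0 ≤ z k := hz.1 k
    have h1 : z k ≤ 1 := hz.2 k
    rw [min_eq_left h1, max_eq_right h0]
  have hbox : ∀ y ∈ Icc (0 : Fin n → ℝ) 1, ∀ x ∈ Icc (0 : Fin n → ℝ) 1,
      boxIncr f y x = boxIncr g y x := by
    intro y hy x hx
    unfold boxIncr
    refine Finset.sum_congr rfl fun S _ => ?_
    rw [hgf]
    refine ⟨fun k => ?_, fun k => ?_⟩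
    · by_cases hk : k ∈ S
      · simpa [hk] using hy.1 k
      · simpa [hk] using hx.1 k
    · by_cases hk : k ∈ S
      · simpa [hk] using hy.2 k
      · simpa [hk] using hx.2 k
  have hint : ∫⁻ x in Icc (0 : Fin n → ℝ) 1, ∫⁻ y in Icc (0 : Fin n → ℝ) 1,
        ENNReal.ofReal (|boxIncr f y x| ^ α / ∏ k, |x k - y k| ^ (α * γ k)) =
      ∫⁻ x in Icc (0 : Fin n → ℝ) 1, ∫⁻ y in Icc (0 : Fin n → ℝ) 1,
        ENNReal.ofReal (|boxIncr g y x| ^ α / ∏ k, |x k - y k| ^ (α * γ k)) := by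
    refine setLIntegral_congr_fun measurableSet_Icc fun x hx => ?_
    refine setLIntegral_congr_fun measurableSet_Icc fun y hy => ?_
    simp only [hbox y hy x hx]
  rw [hint, hbox s hs t ht]
  have h := ENNReal.rpow_le_rpow (ms_multi α hα n γ hγ g hgc s hs t ht)
    (show 0 ≤ 1 / α by positivity)
  rw [ENNReal.mul_rpow_of_nonneg _ _ (by positivity), ← ENNReal.rpow_mul, ← ENNReal.rpow_mul,
    mul_one_div_cancel hα.ne', ENNReal.rpow_one, ENNReal.rpow_one] at h
  rwa [ENNReal.ofReal_pow (by norm_num), ENNReal.ofReal_ofNat]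
end

section
/- Let u : Ω × ((0,1] × [0,1]) → ℝ be a jointly measurable random field with continuous sample paths such that for every (s,x), (t,y) ∈ (0,1] × [0,1] the law of the rectangular increment u(t,y) − u(t,x) − u(s,y) + u(s,x) is the Gaussian measure on ℝ with mean 0 and variance V(s,t,x,y), where V(s,t,x,y) = Q((s,x),(s,x)) + Q((t,x),(t,x)) + Q((s,y),(s,y)) + Q((t,y),(t,y)) − 2Q((s,x),(t,x)) − 2Q((s,x),(s,y)) + 2Q((s,x),(t,y)) + 2Q((t,x),(s,y)) − 2Q((t,x),(t,y)) − 2Q((s,y),(t,y)) and Q((s,x),(t,y)) = ∫₀^{min(s,t)} p_{s+t−2r}(x−y) dr with p_t(y) = (2πt)^{−1/2} e^{−y²/(2t)}. Then for every α ∈ [0, 1/4] there exists a deterministic constant κ_α < ∞ such that almost surely, lim_{δ↓0} sup { |u(t,y) − u(t,x) − u(s,y) + u(s,x)| / (|t−s|^{1/4−α} |x−y|^{2α} |log(|t−s| |x−y|)|^{1/2}) : (s,x),(t,y) ∈ (0,1] × [0,1], s ≠ t, x ≠ y, |t−s| ≤ δ, |x−y| ≤ δ } ≤ κ_α. -/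
open MeasureTheory ProbabilityTheory Set ENNReal

/-- One-dimensional heat kernel `p_t(y) = (2πt)^{−1/2} e^{−y²/(2t)}`. -/
noncomputable def heatK (t y : ℝ) : ℝ :=
  (Real.sqrt (2 * Real.pi * t))⁻¹ * Real.exp (-y ^ 2 / (2 * t))

/-- Covariance `Q((s,x),(t,y)) = ∫₀^{s∧t} p_{s+t−2r}(x−y) dr` of the mild solution of
the stochastic heat equation with additive space-time white noise. -/
noncomputable def heatQ (s x t y : ℝ) : ℝ :=
  ∫ r in Set.Ioc (0:ℝ) (min s t), heatK (s + t - 2 * r) (x - y)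

/-- Second moment `V(s,t,x,y) = E[(u(t,y) − u(t,x) − u(s,y) + u(s,x))²]` of the
rectangular increment, expressed through the covariance `Q`. -/
noncomputable def heatV (s t x y : ℝ) : ℝ :=
  heatQ s x s x + heatQ t x t x + heatQ s y s y + heatQ t y t y
    - 2 * heatQ s x t x - 2 * heatQ s x s y + 2 * heatQ s x t y
    + 2 * heatQ t x s y - 2 * heatQ t x t y - 2 * heatQ s y t y

namespace SheAux

lemma heatK_zero (b : ℝ) : heatK b 0 = (Real.sqrt (2 * Real.pi * b))⁻¹ := by
  simp [heatK]

lemma heatK_neg (b z : ℝ) : heatK b (-z) = heatK b z := by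
  simp [heatK]

lemma heatK_nonneg (b z : ℝ) : 0 ≤ heatK b z := by
  unfold heatK; positivity

lemma heatK_le (b z : ℝ) : heatK b z ≤ heatK b 0 := by
  rw [heatK_zero]
  unfold heatK
  rcases le_or_gt b 0 with hb | hb
  · rw [Real.sqrt_eq_zero_of_nonpos]
    · simp
    · have := Real.pi_pos
      nlinarith
  · apply mul_le_of_le_one_right (by positivity)
    rw [Real.exp_le_one_iff]
    apply div_nonpos_of_nonpos_of_nonneg
    · nlinarith [sq_nonneg z]
    · positivity

lemma measurable_heatK (z : ℝ) : Measurable (fun b => heatK b z) := by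
  unfold heatK; fun_prop

lemma int_heatK_zero (a b : ℝ) : IntervalIntegrable (fun b => heatK b 0) volume a b := by
  suffices H : ∀ b, IntervalIntegrable (fun b => heatK b 0) volume 0 b from (H a).symm.trans (H b)
  intro b
  rcases le_total 0 b with hb | hb
  · have h1 : IntervalIntegrable (fun r : ℝ => (Real.sqrt (2 * Real.pi))⁻¹ * r ^ (-(1/2) : ℝ))
        volume 0 b := (intervalIntegral.intervalIntegrable_rpow' (by norm_num)).const_mul _
    refine h1.congr ?_
    intro r hr
    rw [uIoc_of_le hb] at hr
    simp only [heatK_zero]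
    rw [Real.sqrt_mul (by positivity : 0 ≤ 2 * Real.pi) r, mul_inv, Real.rpow_neg hr.1.le,
      Real.sqrt_eq_rpow r]
  · have h1 : IntervalIntegrable (fun r : ℝ => (0:ℝ)) volume 0 b := intervalIntegrable_const
    refine h1.congr ?_
    intro r hr
    rw [uIoc_of_ge hb] at hr
    simp only [heatK_zero]
    rw [Real.sqrt_eq_zero_of_nonpos]
    · simp
    · have := Real.pi_pos
      nlinarith [hr.2]

lemma int_heatK (z a b : ℝ) : IntervalIntegrable (fun b => heatK b z) volume a b := by
  refine (int_heatK_zero a b).mono_fun (measurable_heatK z).aestronglyMeasurable ?_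
  filter_upwards with r
  rw [Real.norm_of_nonneg (heatK_nonneg _ _), Real.norm_of_nonneg (heatK_nonneg _ _)]
  exact heatK_le r z

lemma heatQ_eq {s t : ℝ} (hs : 0 ≤ s) (ht : 0 ≤ t) (x y : ℝ) :
    heatQ s x t y = (1/2) * ((∫ b in (0:ℝ)..(s+t), heatK b (x - y))
      - ∫ b in (0:ℝ)..|t - s|, heatK b (x - y)) := by
  unfold heatQ
  rw [← intervalIntegral.integral_of_le (le_min hs ht),
    intervalIntegral.integral_comp_sub_mul (fun b => heatK b (x - y)) (by norm_num : (2:ℝ) ≠ 0)]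
  have h1 : s + t - 2 * min s t = |t - s| := by
    rcases le_total s t with h | h
    · rw [min_eq_left h, abs_of_nonneg (by linarith)]; ring
    · rw [min_eq_right h, abs_of_nonpos (by linarith)]; ring
  rw [h1, ← intervalIntegral.integral_interval_sub_left (int_heatK _ 0 _) (int_heatK _ _ _)]
  simp

/-- difference kernel -/
noncomputable def phi (z b : ℝ) : ℝ := heatK b 0 - heatK b z

lemma phi_nonneg (z b : ℝ) : 0 ≤ phi z b := sub_nonneg.2 (heatK_le b z)

lemma int_phi (z a b : ℝ) : IntervalIntegrable (phi z) volume a b :=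
  (int_heatK_zero a b).sub (int_heatK z a b)

lemma heatV_eq {s t : ℝ} (hs : 0 ≤ s) (ht : 0 ≤ t) (x y : ℝ) :
    heatV s t x y = (∫ b in (0:ℝ)..(2*s), phi (x-y) b) + (∫ b in (0:ℝ)..(2*t), phi (x-y) b)
      - 2 * (∫ b in (0:ℝ)..(s+t), phi (x-y) b) + 2 * (∫ b in (0:ℝ)..|t-s|, phi (x-y) b) := by
  have e : ∀ a : ℝ, ∫ b in (0:ℝ)..a, phi (x-y) b
      = (∫ b in (0:ℝ)..a, heatK b 0) - ∫ b in (0:ℝ)..a, heatK b (x-y) := fun a =>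
    intervalIntegral.integral_sub (int_heatK_zero _ _) (int_heatK _ _ _)
  unfold heatV
  simp only [heatQ_eq hs ht, heatQ_eq hs hs, heatQ_eq ht ht, heatQ_eq ht hs, e, sub_self, abs_zero,
    intervalIntegral.integral_same, ← two_mul, abs_sub_comm s t, add_comm t s]
  ring

lemma phi_time_bound (z : ℝ) {a b : ℝ} (ha : 0 ≤ a) (hab : a ≤ b) :
    ∫ r in a..b, phi z r ≤ Real.sqrt (b - a) := by
  have key : ∫ r in a..b, phi z r ≤ Real.sqrt b - Real.sqrt a := by
    refine intervalIntegral.integral_le_sub_of_hasDeriv_right_of_le (g := Real.sqrt)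
      (g' := fun r => 1 / (2 * Real.sqrt r)) hab Real.continuous_sqrt.continuousOn ?_ ?_ ?_
    · intro r hr
      exact (Real.hasDerivAt_sqrt (by linarith [hr.1])).hasDerivWithinAt
    · rw [← intervalIntegrable_iff_integrableOn_Icc_of_le hab]
      exact int_phi z a b
    · intro r hr
      have hr0 : 0 < r := by linarith [hr.1]
      have : phi z r ≤ heatK r 0 := by
        unfold phi; linarith [heatK_nonneg r z]
      refine this.trans ?_
      rw [heatK_zero, ← one_div]
      apply one_div_le_one_div_of_le (by positivity)
      apply Real.le_sqrt_of_sq_le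
      rw [mul_pow, Real.sq_sqrt hr0.le]
      nlinarith [Real.pi_gt_three]
  refine key.trans ?_
  rw [sub_le_iff_le_add]
  apply Real.sqrt_le_iff.2 ⟨by positivity, ?_⟩
  have h1 := Real.sq_sqrt ha
  have h2 := Real.sq_sqrt (sub_nonneg.2 hab)
  nlinarith [mul_nonneg (Real.sqrt_nonneg a) (Real.sqrt_nonneg (b - a))]

lemma phi_space_bound (z : ℝ) {a : ℝ} (ha : 0 ≤ a) :
    ∫ r in (0:ℝ)..a, phi z r ≤ 2 * |z| := by
  rcases eq_or_ne z 0 with rfl | hz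
  · simp [phi]
  have hz' : 0 < |z| := abs_pos.2 hz
  have key : ∫ r in (0:ℝ)..a, phi z r ≤ 2 / Real.sqrt Real.pi * |z| * Real.arctan (Real.sqrt (2 * a) / |z|)
      - 2 / Real.sqrt Real.pi * |z| * Real.arctan (Real.sqrt (2 * 0) / |z|) := by
    refine intervalIntegral.integral_le_sub_of_hasDeriv_right_of_le
      (g := fun r => 2 / Real.sqrt Real.pi * |z| * Real.arctan (Real.sqrt (2 * r) / |z|))
      (g' := fun r => 2 / Real.sqrt Real.pi * |z| *
        (1 / (1 + (Real.sqrt (2 * r) / |z|)^2) * (2 * 1 / (2 * Real.sqrt (2 * r)) / |z|))) ha ?_ ?_ ?_ ?_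
    · apply Continuous.continuousOn
      have := Real.continuous_arctan
      fun_prop
    · intro r hr
      have hr0 : 0 < r := hr.1
      apply HasDerivAt.hasDerivWithinAt
      have h1 : HasDerivAt (fun r : ℝ => Real.sqrt (2 * r)) (2 * 1 / (2 * Real.sqrt (2 * r))) r :=
        ((hasDerivAt_id r).const_mul 2).sqrt (by simp; linarith)
      exact ((h1.div_const |z|).arctan).const_mul _
    · rw [← intervalIntegrable_iff_integrableOn_Icc_of_le ha]
      exact int_phi z 0 a
    · intro r hr
      have hr0 : 0 < r := hr.1
      have hpi := Real.pi_pos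
      have e1 : phi z r = (Real.sqrt (2 * r))⁻¹ * (Real.sqrt Real.pi)⁻¹
          * (1 - Real.exp (-(z^2 / (2*r)))) := by
        unfold phi
        rw [heatK_zero, heatK, show 2 * Real.pi * r = 2 * r * Real.pi by ring,
          Real.sqrt_mul (by positivity), mul_inv, neg_div]
        ring
      rw [e1, div_pow, Real.sq_sqrt (by positivity), sq_abs]
      have hw : 0 < z^2 / (2*r) := by positivity
      have e2 : 1 - Real.exp (-(z^2/(2*r))) ≤ 2 * (1 / (1 + 2 * r / z^2)) := by
        have e3 : 1 / (1 + 2 * r / z^2) = (z^2/(2*r)) / (1 + z^2/(2*r)) := by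
          field_simp
          ring
        rw [e3]
        set w := z^2/(2*r)
        have h1 : 1 - Real.exp (-w) ≤ w := by linarith [Real.add_one_le_exp (-w)]
        have h2 : 1 - Real.exp (-w) ≤ 1 := by linarith [Real.exp_pos (-w)]
        rw [← mul_div_assoc, le_div_iff₀ (by positivity)]
        nlinarith
      calc _ ≤ (Real.sqrt (2 * r))⁻¹ * (Real.sqrt Real.pi)⁻¹ * (2 * (1 / (1 + 2 * r / z^2))) := by
            gcongr
        _ = _ := by field_simp
  refine key.trans ?_
  have h1 : Real.arctan (Real.sqrt (2 * a) / |z|) ≤ Real.pi / 2 := (Real.arctan_lt_pi_div_two _).le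
  have h2 : Real.sqrt Real.pi ≤ 2 := by
    rw [Real.sqrt_le_left (by norm_num)]
    linarith [Real.pi_lt_four]
  have hsp : 0 < Real.sqrt Real.pi := Real.sqrt_pos.2 Real.pi_pos
  calc _ = 2 / Real.sqrt Real.pi * |z| * Real.arctan (Real.sqrt (2 * a) / |z|) := by simp
    _ ≤ 2 / Real.sqrt Real.pi * |z| * (Real.pi / 2) := by gcongr
    _ = |z| * Real.sqrt Real.pi := by
        have := Real.sq_sqrt Real.pi_pos.le
        field_simp
        nlinarith
    _ ≤ _ := by nlinarith

lemma int_phi_nonneg (z : ℝ) {a b : ℝ} (hab : a ≤ b) : 0 ≤ ∫ r in a..b, phi z r :=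
  intervalIntegral.integral_nonneg hab (fun r _ => phi_nonneg z r)

lemma heatV_space {s t : ℝ} (hs : 0 ≤ s) (ht : 0 ≤ t) (x y : ℝ) :
    heatV s t x y ≤ 8 * |x - y| := by
  rw [heatV_eq hs ht]
  have h1 := phi_space_bound (x-y) (a := 2*s) (by linarith)
  have h2 := phi_space_bound (x-y) (a := 2*t) (by linarith)
  have h3 := phi_space_bound (x-y) (a := |t-s|) (by positivity)
  have h4 := int_phi_nonneg (x-y) (a := 0) (b := s+t) (by linarith)
  linarith

lemma heatV_time_aux {s t : ℝ} (hs : 0 ≤ s) (hst : s ≤ t) (x y : ℝ) :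
    heatV s t x y ≤ 8 * Real.sqrt |t - s| := by
  rw [heatV_eq hs (hs.trans hst), abs_of_nonneg (sub_nonneg.2 hst)]
  have h1 := phi_time_bound (x-y) (a := 0) (b := t - s) le_rfl (by linarith)
  have h2 := phi_time_bound (x-y) (a := s + t) (b := 2 * t) (by linarith) (by linarith)
  have h3 := int_phi_nonneg (x-y) (a := 2*s) (b := s+t) (by linarith)
  rw [show 2 * t - (s + t) = t - s by ring] at h2
  rw [← intervalIntegral.integral_interval_sub_left (int_phi _ 0 _) (int_phi _ _ _)] at h2 h3
  rw [sub_zero] at h1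
  linarith [Real.sqrt_nonneg (t - s)]

lemma heatV_time {s t : ℝ} (hs : 0 ≤ s) (ht : 0 ≤ t) (x y : ℝ) :
    heatV s t x y ≤ 8 * Real.sqrt |t - s| := by
  rcases le_total s t with h | h
  · exact heatV_time_aux hs h x y
  · have : heatV s t x y = heatV t s x y := by
      rw [heatV_eq hs ht, heatV_eq ht hs, abs_sub_comm, add_comm s t]; ring
    rw [this, abs_sub_comm]
    exact heatV_time_aux ht h x y


lemma gauss_tail {Ω : Type*} [MeasurableSpace Ω] (P : Measure Ω) [IsProbabilityMeasure P]
    {X : Ω → ℝ} {v c : NNReal} (hX : P.map X = gaussianReal 0 v) (hm : Measurable X)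
    (hv : v ≤ c) {ε : ℝ} (hε : 0 ≤ ε) :
    P {ω | ε ≤ |X ω|} ≤ ENNReal.ofReal (2 * Real.exp (-ε ^ 2 / (2 * c))) := by
  have hsub : HasSubgaussianMGF X c P := by
    constructor
    · intro t
      have h := integrable_exp_mul_gaussianReal (μ := 0) (v := v) t
      rw [← hX] at h
      exact (integrable_map_measure (by fun_prop) hm.aemeasurable).1 h
    · intro t
      rw [mgf_gaussianReal hX, Real.exp_le_exp]
      have : (v:ℝ) ≤ c := hv
      nlinarith [sq_nonneg t]
  have h1 := hsub.measure_ge_le hε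
  have h2 := hsub.neg.measure_ge_le hε
  have hsubset : {ω | ε ≤ |X ω|} ⊆ {ω | ε ≤ X ω} ∪ {ω | ε ≤ (-X) ω} := by
    intro ω hω
    rcases le_abs.1 (show ε ≤ |X ω| from hω) with h | h
    · exact Or.inl h
    · exact Or.inr h
  calc P {ω | ε ≤ |X ω|} ≤ P {ω | ε ≤ X ω} + P {ω | ε ≤ (-X) ω} :=
        (measure_mono hsubset).trans (measure_union_le _ _)
    _ ≤ ENNReal.ofReal (Real.exp (-ε ^ 2 / (2 * c))) + ENNReal.ofReal (Real.exp (-ε ^ 2 / (2 * c))) := by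
        gcongr
        · rw [← ofReal_measureReal]; exact ENNReal.ofReal_le_ofReal h1
        · rw [← ofReal_measureReal]; exact ENNReal.ofReal_le_ofReal h2
    _ = _ := by rw [← ENNReal.ofReal_add (by positivity) (by positivity)]; ring_nf

/-- chaining scale -/
noncomputable def eps (n : ℕ) : ℝ := 8 * Real.sqrt (n / 2 ^ n)

lemma eps_nonneg (n : ℕ) : 0 ≤ eps n := by unfold eps; positivity

lemma gauss_tail_eps {Ω : Type*} [MeasurableSpace Ω] (P : Measure Ω) [IsProbabilityMeasure P]
    {X : Ω → ℝ} {V : ℝ} (hX : P.map X = gaussianReal 0 (Real.toNNReal V)) (hm : Measurable X)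
    (n : ℕ) (hV : V ≤ 8 / 2 ^ n) :
    P {ω | eps n ≤ |X ω|} ≤ ENNReal.ofReal (2 * Real.exp (-4) ^ n) := by
  have h := gauss_tail P hX hm (c := Real.toNNReal (8 / 2 ^ n)) (Real.toNNReal_le_toNNReal hV)
    (eps_nonneg n)
  refine h.trans (le_of_eq ?_)
  rw [Real.coe_toNNReal _ (by positivity), ← Real.exp_nat_mul, eps, mul_pow,
    Real.sq_sqrt (by positivity)]
  congr 3
  field_simp
  ring

/-- all neighbouring grid increments at level `n` are small -/
def Good (f : ℝ × ℝ → ℝ) (n : ℕ) : Prop :=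
  (∀ i j : ℕ, 1 ≤ i → i + 1 ≤ 4 ^ n → j ≤ 2 ^ n →
    |f (((i + 1 : ℕ) : ℝ) / 4 ^ n, (j : ℝ) / 2 ^ n) - f ((i : ℝ) / 4 ^ n, (j : ℝ) / 2 ^ n)| ≤ eps n) ∧
  (∀ i j : ℕ, 1 ≤ i → i ≤ 4 ^ n → j + 1 ≤ 2 ^ n →
    |f ((i : ℝ) / 4 ^ n, ((j + 1 : ℕ) : ℝ) / 2 ^ n) - f ((i : ℝ) / 4 ^ n, (j : ℝ) / 2 ^ n)| ≤ eps n)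

lemma grid_t {n i : ℕ} (h1 : 1 ≤ i) (h2 : i ≤ 4 ^ n) : (i : ℝ) / 4 ^ n ∈ Ioc (0:ℝ) 1 := by
  have h1' : (1:ℝ) ≤ i := by exact_mod_cast h1
  have h2' : (i:ℝ) ≤ 4 ^ n := by exact_mod_cast h2
  refine ⟨by positivity, ?_⟩
  rw [div_le_one (by positivity)]; exact h2'

lemma grid_x {n i : ℕ} (h2 : i ≤ 2 ^ n) : (i : ℝ) / 2 ^ n ∈ Icc (0:ℝ) 1 := by
  have h2' : (i:ℝ) ≤ 2 ^ n := by exact_mod_cast h2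
  refine ⟨by positivity, ?_⟩
  rw [div_le_one (by positivity)]; exact h2'

lemma exp_bound : Real.exp (-4) ≤ 1 / 16 := by
  rw [Real.exp_neg, ← one_div]
  apply one_div_le_one_div_of_le (by norm_num)
  have h : Real.exp 4 = Real.exp 1 ^ 4 := by rw [← Real.exp_nat_mul]; norm_num
  rw [h]
  have h2 : (2:ℝ) ≤ Real.exp 1 := by linarith [Real.add_one_le_exp (1:ℝ)]
  calc (16:ℝ) = 2 ^ 4 := by norm_num
    _ ≤ _ := by gcongr

lemma ae_good {Ω : Type*} [MeasurableSpace Ω] (P : Measure Ω) [IsProbabilityMeasure P]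
    (v : Ω → ℝ × ℝ → ℝ)
    (ht : ∀ n : ℕ, ∀ s ∈ Ioc (0:ℝ) 1, ∀ t ∈ Ioc (0:ℝ) 1, ∀ x ∈ Icc (0:ℝ) 1, |t - s| ≤ 1 / 4 ^ n →
      P {ω | eps n ≤ |v ω (t, x) - v ω (s, x)|} ≤ ENNReal.ofReal (2 * Real.exp (-4) ^ n))
    (hx : ∀ n : ℕ, ∀ t ∈ Ioc (0:ℝ) 1, ∀ x ∈ Icc (0:ℝ) 1, ∀ y ∈ Icc (0:ℝ) 1, |y - x| ≤ 1 / 2 ^ n →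
      P {ω | eps n ≤ |v ω (t, y) - v ω (t, x)|} ≤ ENNReal.ofReal (2 * Real.exp (-4) ^ n)) :
    ∀ᵐ ω ∂P, ∃ N : ℕ, ∀ n ≥ N, Good (v ω) n := by
  let A : ℕ → Set Ω := fun n => ⋃ p ∈ Finset.Ico (α := ℕ) 1 (4 ^ n) ×ˢ Finset.range (2 ^ n + 1),
    {ω | eps n ≤ |v ω (((p.1 + 1 : ℕ) : ℝ) / 4 ^ n, (p.2 : ℝ) / 2 ^ n)
      - v ω ((p.1 : ℝ) / 4 ^ n, (p.2 : ℝ) / 2 ^ n)|}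
  let B : ℕ → Set Ω := fun n => ⋃ p ∈ Finset.Ico (α := ℕ) 1 (4 ^ n + 1) ×ˢ Finset.range (2 ^ n),
    {ω | eps n ≤ |v ω ((p.1 : ℝ) / 4 ^ n, ((p.2 + 1 : ℕ) : ℝ) / 2 ^ n)
      - v ω ((p.1 : ℝ) / 4 ^ n, (p.2 : ℝ) / 2 ^ n)|}
  have cardb : ∀ (n : ℕ) (c : ℕ), c ≤ 2 * 8 ^ n →
      (c : ℝ≥0∞) * ENNReal.ofReal (2 * Real.exp (-4) ^ n) ≤ ENNReal.ofReal (4 * (1/2) ^ n) := by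
    intro n c hc
    rw [← ENNReal.ofReal_natCast, ← ENNReal.ofReal_mul (by positivity)]
    apply ENNReal.ofReal_le_ofReal
    have hc' : (c:ℝ) ≤ 2 * 8 ^ n := by exact_mod_cast hc
    calc (c:ℝ) * (2 * Real.exp (-4) ^ n) ≤ (2 * 8 ^ n) * (2 * (1/16) ^ n) := by
          have := exp_bound
          gcongr
      _ = 4 * (8 * (1/16)) ^ n := by rw [mul_pow]; ring
      _ = _ := by norm_num
  have hp : ∀ n : ℕ, 1 ≤ 2 ^ n ∧ (8:ℕ) ^ n = 4 ^ n * 2 ^ n ∧ 1 ≤ 4 ^ n := fun n =>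
    ⟨Nat.one_le_two_pow, by rw [← mul_pow]; norm_num, Nat.one_le_pow _ _ (by norm_num)⟩
  have hA : ∀ n, P (A n) ≤ ENNReal.ofReal (4 * (1/2) ^ n) := by
    intro n
    refine (measure_biUnion_finset_le _ _).trans ?_
    refine (Finset.sum_le_card_nsmul _ _ (ENNReal.ofReal (2 * Real.exp (-4) ^ n)) ?_).trans ?_
    · rintro ⟨i, j⟩ hp
      simp only [Finset.mem_product, Finset.mem_Ico, Finset.mem_range] at hp
      refine ht n _ (grid_t hp.1.1 (by omega)) _ (grid_t (by omega) (by omega)) _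
        (grid_x (by omega)) ?_
      rw [← sub_div]; push_cast
      rw [add_sub_cancel_left, abs_of_nonneg (by positivity)]
    · rw [nsmul_eq_mul]
      apply cardb
      rw [Finset.card_product, Nat.card_Ico, Finset.card_range]
      obtain ⟨h1, h2, h3⟩ := hp n
      rw [h2]
      calc (4 ^ n - 1) * (2 ^ n + 1) ≤ 4 ^ n * (2 * 2 ^ n) :=
            Nat.mul_le_mul (by omega) (by omega)
        _ = _ := by ring
  have hB : ∀ n, P (B n) ≤ ENNReal.ofReal (4 * (1/2) ^ n) := by
    intro n
    refine (measure_biUnion_finset_le _ _).trans ?_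
    refine (Finset.sum_le_card_nsmul _ _ (ENNReal.ofReal (2 * Real.exp (-4) ^ n)) ?_).trans ?_
    · rintro ⟨i, j⟩ hp
      simp only [Finset.mem_product, Finset.mem_Ico, Finset.mem_range] at hp
      refine hx n _ (grid_t hp.1.1 (by omega)) _ (grid_x (by omega)) _
        (grid_x (by omega)) ?_
      rw [← sub_div]; push_cast
      rw [add_sub_cancel_left, abs_of_nonneg (by positivity)]
    · rw [nsmul_eq_mul]
      apply cardb
      rw [Finset.card_product, Nat.card_Ico, Finset.card_range]
      obtain ⟨h1, h2, h3⟩ := hp n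
      rw [h2]
      calc (4 ^ n + 1 - 1) * (2 ^ n) ≤ 4 ^ n * (2 * 2 ^ n) :=
            Nat.mul_le_mul (by omega) (by omega)
        _ = _ := by ring
  have hsum : ∑' n : ℕ, ENNReal.ofReal (4 * (1/2) ^ n) ≠ ⊤ := by
    have : Summable (fun n : ℕ => (4:ℝ) * (1/2) ^ n) :=
      (summable_geometric_of_lt_one (by norm_num) (by norm_num)).mul_left _
    rw [← ENNReal.ofReal_tsum_of_nonneg (fun n => by positivity) this]
    exact ENNReal.ofReal_ne_top
  have hA' := ae_eventually_notMem (ne_top_of_le_ne_top hsum (ENNReal.tsum_le_tsum hA))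
  have hB' := ae_eventually_notMem (ne_top_of_le_ne_top hsum (ENNReal.tsum_le_tsum hB))
  filter_upwards [hA', hB'] with ω h1 h2
  obtain ⟨N, hN⟩ := Filter.eventually_atTop.1 (h1.and h2)
  refine ⟨N, fun n hn => ?_⟩
  obtain ⟨g1, g2⟩ := hN n hn
  constructor
  · intro i j hi hi' hj
    by_contra hcon
    refine g1 (mem_iUnion₂.2 ⟨(i, j), ?_, (not_le.1 hcon).le⟩)
    simp only [Finset.mem_product, Finset.mem_Ico, Finset.mem_range]
    omega
  · intro i j hi hi' hj
    by_contra hcon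
    refine g2 (mem_iUnion₂.2 ⟨(i, j), ?_, (not_le.1 hcon).le⟩)
    simp only [Finset.mem_product, Finset.mem_Ico, Finset.mem_range]
    omega

lemma good_t {f : ℝ × ℝ → ℝ} {n : ℕ} (hg : Good f n) (i j : ℕ) (hi : 1 ≤ i) (hj : j ≤ 2 ^ n) (k : ℕ)
    (hk : i + k ≤ 4 ^ n) :
    |f (((i + k : ℕ) : ℝ) / 4 ^ n, (j : ℝ) / 2 ^ n) - f ((i : ℝ) / 4 ^ n, (j : ℝ) / 2 ^ n)|
      ≤ k * eps n := by
  induction k with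
  | zero => simp
  | succ k ih =>
    have h1 := ih (by omega)
    have h2 := hg.1 (i + k) j (by omega) (by omega) hj
    rw [← add_assoc]
    refine (abs_sub_le _ _ _).trans ((add_le_add h2 h1).trans ?_)
    push_cast; linarith

lemma good_x {f : ℝ × ℝ → ℝ} {n : ℕ} (hg : Good f n) (i j : ℕ) (hi : 1 ≤ i) (hi' : i ≤ 4 ^ n) (k : ℕ)
    (hk : j + k ≤ 2 ^ n) :
    |f ((i : ℝ) / 4 ^ n, ((j + k : ℕ) : ℝ) / 2 ^ n) - f ((i : ℝ) / 4 ^ n, (j : ℝ) / 2 ^ n)|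
      ≤ k * eps n := by
  induction k with
  | zero => simp
  | succ k ih =>
    have h1 := ih (by omega)
    have h2 := hg.2 i (j + k) hi hi' (by omega)
    rw [← add_assoc]
    refine (abs_sub_le _ _ _).trans ((add_le_add h2 h1).trans ?_)
    push_cast; linarith

/-- general grid increment -/
lemma good_gen {f : ℝ × ℝ → ℝ} {n : ℕ} (hg : Good f n) (i j i' j' a b : ℕ) (hi : 1 ≤ i)
    (hi' : 1 ≤ i') (hin : i ≤ 4 ^ n) (hin' : i' ≤ 4 ^ n) (hj : j ≤ 2 ^ n) (hj' : j' ≤ 2 ^ n)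
    (h1 : i' ≤ i + a) (h2 : i ≤ i' + a) (h3 : j' ≤ j + b) (h4 : j ≤ j' + b) :
    |f ((i' : ℝ) / 4 ^ n, (j' : ℝ) / 2 ^ n) - f ((i : ℝ) / 4 ^ n, (j : ℝ) / 2 ^ n)|
      ≤ (a + b) * eps n := by
  have he := eps_nonneg n
  have ht : |f ((i' : ℝ) / 4 ^ n, (j' : ℝ) / 2 ^ n) - f ((i : ℝ) / 4 ^ n, (j' : ℝ) / 2 ^ n)|
      ≤ a * eps n := by
    rcases le_total i i' with h | h
    · obtain ⟨k, rfl⟩ := Nat.exists_eq_add_of_le h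
      have := good_t hg i j' hi hj' k hin'
      have hk : (k:ℝ) ≤ a := by exact_mod_cast (by omega : k ≤ a)
      exact this.trans (by gcongr)
    · obtain ⟨k, rfl⟩ := Nat.exists_eq_add_of_le h
      have := good_t hg i' j' hi' hj' k hin
      have hk : (k:ℝ) ≤ a := by exact_mod_cast (by omega : k ≤ a)
      rw [abs_sub_comm]
      exact this.trans (by gcongr)
  have hx : |f ((i : ℝ) / 4 ^ n, (j' : ℝ) / 2 ^ n) - f ((i : ℝ) / 4 ^ n, (j : ℝ) / 2 ^ n)|
      ≤ b * eps n := by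
    rcases le_total j j' with h | h
    · obtain ⟨k, rfl⟩ := Nat.exists_eq_add_of_le h
      have := good_x hg i j hi hin k hj'
      have hk : (k:ℝ) ≤ b := by exact_mod_cast (by omega : k ≤ b)
      exact this.trans (by gcongr)
    · obtain ⟨k, rfl⟩ := Nat.exists_eq_add_of_le h
      have := good_x hg i j' hi hin k hj
      have hk : (k:ℝ) ≤ b := by exact_mod_cast (by omega : k ≤ b)
      rw [abs_sub_comm]
      exact this.trans (by gcongr)
  refine (abs_sub_le _ _ _).trans ((add_le_add ht hx).trans ?_)
  linarith

lemma eps_step {k : ℕ} (hk : 2 ≤ k) : 4 * eps (k + 1) ≤ 26 * eps k - 26 * eps (k + 1) := by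
  have hk' : (2:ℝ) ≤ k := by exact_mod_cast hk
  have h : 30 * Real.sqrt (((k + 1 : ℕ) : ℝ) / 2 ^ (k + 1)) ≤ 26 * Real.sqrt ((k : ℝ) / 2 ^ k) := by
    have h30 : (30:ℝ) = Real.sqrt (30 ^ 2) := by rw [Real.sqrt_sq (by norm_num)]
    have h26 : (26:ℝ) = Real.sqrt (26 ^ 2) := by rw [Real.sqrt_sq (by norm_num)]
    rw [h30, h26, ← Real.sqrt_mul (by norm_num), ← Real.sqrt_mul (by norm_num)]
    apply Real.sqrt_le_sqrt
    rw [pow_succ (2:ℝ) k]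
    push_cast
    rw [← mul_div_assoc, ← mul_div_assoc, div_le_div_iff₀ (by positivity) (by positivity)]
    have : (0:ℝ) < 2 ^ k := by positivity
    nlinarith
  unfold eps
  linarith

lemma ceil_t {n : ℕ} {t : ℝ} (ht : t ∈ Ioc (0:ℝ) 1) :
    1 ≤ ⌈(4:ℝ) ^ n * t⌉₊ ∧ ⌈(4:ℝ) ^ n * t⌉₊ ≤ 4 ^ n := by
  constructor
  · have : 0 < (4:ℝ) ^ n * t := mul_pos (by positivity) ht.1
    exact Nat.ceil_pos.2 this
  · rw [Nat.ceil_le]; push_cast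
    exact mul_le_of_le_one_right (by positivity) ht.2

lemma ceil_x {n : ℕ} {x : ℝ} (hx : x ∈ Icc (0:ℝ) 1) : ⌈(2:ℝ) ^ n * x⌉₊ ≤ 2 ^ n := by
  rw [Nat.ceil_le]; push_cast
  exact mul_le_of_le_one_right (by positivity) hx.2

/-- grid approximation of a point -/
noncomputable def apx (n : ℕ) (t x : ℝ) : ℝ × ℝ :=
  ((⌈(4:ℝ) ^ n * t⌉₊ : ℝ) / 4 ^ n, (⌈(2:ℝ) ^ n * x⌉₊ : ℝ) / 2 ^ n)

lemma apx_step {f : ℝ × ℝ → ℝ} {n : ℕ} (hg : Good f (n + 1)) {t x : ℝ} (ht : t ∈ Ioc (0:ℝ) 1)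
    (hx : x ∈ Icc (0:ℝ) 1) : |f (apx (n + 1) t x) - f (apx n t x)| ≤ 4 * eps (n + 1) := by
  have e : apx n t x = (((4 * ⌈(4:ℝ) ^ n * t⌉₊ : ℕ) : ℝ) / 4 ^ (n + 1),
      ((2 * ⌈(2:ℝ) ^ n * x⌉₊ : ℕ) : ℝ) / 2 ^ (n + 1)) := by
    unfold apx
    push_cast
    rw [pow_succ, pow_succ, mul_comm (4:ℝ) (⌈(4:ℝ) ^ n * t⌉₊ : ℝ), mul_comm (2:ℝ) (⌈(2:ℝ) ^ n * x⌉₊ : ℝ),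
      mul_div_mul_right _ _ (by norm_num : (4:ℝ) ≠ 0), mul_div_mul_right _ _ (by norm_num : (2:ℝ) ≠ 0)]
  rw [e]
  have hp4 : 4 ^ (n + 1) = 4 * 4 ^ n := by ring
  have hp2 : 2 ^ (n + 1) = 2 * 2 ^ n := by ring
  have ht0 : 0 ≤ (4:ℝ) ^ n * t := mul_nonneg (by positivity) ht.1.le
  have hx0 : 0 ≤ (2:ℝ) ^ n * x := mul_nonneg (by positivity) hx.1
  have c1 := ceil_t (n := n) ht
  have c2 := ceil_t (n := n + 1) ht
  have d1 := ceil_x (n := n) hx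
  have d2 := ceil_x (n := n + 1) hx
  have q1 : ⌈(4:ℝ) ^ (n + 1) * t⌉₊ ≤ 4 * ⌈(4:ℝ) ^ n * t⌉₊ := by
    rw [Nat.ceil_le]; push_cast
    have := Nat.le_ceil ((4:ℝ) ^ n * t)
    rw [pow_succ]; linarith
  have q2 : 4 * ⌈(4:ℝ) ^ n * t⌉₊ < ⌈(4:ℝ) ^ (n + 1) * t⌉₊ + 4 := by
    have h1 := Nat.ceil_lt_add_one ht0
    have h2 := Nat.le_ceil ((4:ℝ) ^ (n + 1) * t)
    rw [pow_succ] at h2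
    have : (4:ℝ) * (⌈(4:ℝ) ^ n * t⌉₊ : ℝ) < (⌈(4:ℝ) ^ (n + 1) * t⌉₊ : ℝ) + 4 := by
      rw [pow_succ]; linarith
    exact_mod_cast this
  have r1 : ⌈(2:ℝ) ^ (n + 1) * x⌉₊ ≤ 2 * ⌈(2:ℝ) ^ n * x⌉₊ := by
    rw [Nat.ceil_le]; push_cast
    have := Nat.le_ceil ((2:ℝ) ^ n * x)
    rw [pow_succ]; linarith
  have r2 : 2 * ⌈(2:ℝ) ^ n * x⌉₊ < ⌈(2:ℝ) ^ (n + 1) * x⌉₊ + 2 := by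
    have h1 := Nat.ceil_lt_add_one hx0
    have h2 := Nat.le_ceil ((2:ℝ) ^ (n + 1) * x)
    rw [pow_succ] at h2
    have : (2:ℝ) * (⌈(2:ℝ) ^ n * x⌉₊ : ℝ) < (⌈(2:ℝ) ^ (n + 1) * x⌉₊ : ℝ) + 2 := by
      rw [pow_succ]; linarith
    exact_mod_cast this
  have := good_gen hg (4 * ⌈(4:ℝ) ^ n * t⌉₊) (2 * ⌈(2:ℝ) ^ n * x⌉₊) ⌈(4:ℝ) ^ (n + 1) * t⌉₊
    ⌈(2:ℝ) ^ (n + 1) * x⌉₊ 3 1 (by omega) c2.1 (by omega) c2.2 (by omega) d2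
    (by omega) (by omega) (by omega) (by omega)
  refine this.trans (le_of_eq ?_)
  norm_num

lemma apx_chain {f : ℝ × ℝ → ℝ} {n : ℕ} (hn : 2 ≤ n) (hg : ∀ m ≥ n, Good f m) {t x : ℝ}
    (ht : t ∈ Ioc (0:ℝ) 1) (hx : x ∈ Icc (0:ℝ) 1) (k : ℕ) :
    |f (apx (n + k) t x) - f (apx n t x)| ≤ 26 * eps n - 26 * eps (n + k) := by
  induction k with
  | zero => simp
  | succ k ih =>
    have h1 := apx_step (hg (n + k + 1) (by omega)) ht hx
    have h2 := eps_step (k := n + k) (by omega)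
    rw [← add_assoc]
    refine (abs_sub_le _ _ _).trans ((add_le_add h1 ih).trans ?_)
    linarith

lemma tendsto_ceil {a : ℝ} (ha : 1 < a) {t : ℝ} (ht : 0 ≤ t) :
    Filter.Tendsto (fun n : ℕ => (⌈a ^ n * t⌉₊ : ℝ) / a ^ n) Filter.atTop (nhds t) := by
  have ha0 : 0 < a := by linarith
  have h := tendsto_pow_atTop_atTop_of_one_lt ha
  have h2 := (tendsto_nat_ceil_mul_div_atTop ht).comp h
  refine h2.congr fun n => ?_
  simp [mul_comm]

lemma tendsto_apx {f : ℝ × ℝ → ℝ} (hf : ContinuousOn f (Ioc (0:ℝ) 1 ×ˢ Icc (0:ℝ) 1)) {t x : ℝ}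
    (ht : t ∈ Ioc (0:ℝ) 1) (hx : x ∈ Icc (0:ℝ) 1) :
    Filter.Tendsto (fun n => f (apx n t x)) Filter.atTop (nhds (f (t, x))) := by
  have h := hf (t, x) ⟨ht, hx⟩
  refine h.tendsto.comp (tendsto_nhdsWithin_iff.2 ⟨?_, ?_⟩)
  · exact (tendsto_ceil (by norm_num) ht.1.le).prodMk_nhds (tendsto_ceil (by norm_num) hx.1)
  · filter_upwards with n
    exact ⟨grid_t (ceil_t ht).1 (ceil_t ht).2, grid_x (ceil_x hx)⟩

lemma apx_lim {f : ℝ × ℝ → ℝ} (hf : ContinuousOn f (Ioc (0:ℝ) 1 ×ˢ Icc (0:ℝ) 1)) {n : ℕ}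
    (hn : 2 ≤ n) (hg : ∀ m ≥ n, Good f m) {t x : ℝ}
    (ht : t ∈ Ioc (0:ℝ) 1) (hx : x ∈ Icc (0:ℝ) 1) :
    |f (t, x) - f (apx n t x)| ≤ 26 * eps n := by
  have h1 := (Filter.tendsto_add_atTop_iff_nat n).2 (tendsto_apx hf ht hx)
  refine le_of_tendsto ((h1.sub_const (f (apx n t x))).abs) ?_
  filter_upwards with k
  have := apx_chain hn hg ht hx k
  rw [add_comm k n]
  linarith [eps_nonneg (n + k)]

lemma ceil_near {a b c : ℝ} (hc : 0 < c) (hb : 0 ≤ b) (h : |a - b| ≤ 1 / c) :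
    ⌈c * a⌉₊ ≤ ⌈c * b⌉₊ + 1 := by
  rw [Nat.ceil_le]
  push_cast
  have h1 := Nat.le_ceil (c * b)
  have h2 := (le_abs_self _).trans h
  have h3 : c * (a - b) ≤ 1 := by
    calc c * (a - b) ≤ c * (1 / c) := by gcongr
      _ = 1 := by field_simp
  linarith

lemma modulus {f : ℝ × ℝ → ℝ} (hf : ContinuousOn f (Ioc (0:ℝ) 1 ×ˢ Icc (0:ℝ) 1)) {n : ℕ}
    (hn : 2 ≤ n) (hg : ∀ m ≥ n, Good f m) {s t x y : ℝ}
    (hs : s ∈ Ioc (0:ℝ) 1) (ht : t ∈ Ioc (0:ℝ) 1) (hx : x ∈ Icc (0:ℝ) 1) (hy : y ∈ Icc (0:ℝ) 1)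
    (hst : |t - s| ≤ 1 / 4 ^ n) (hxy : |x - y| ≤ 1 / 2 ^ n) :
    |f (t, x) - f (s, y)| ≤ 54 * eps n := by
  have h1 := apx_lim hf hn hg ht hx
  have h2 := apx_lim hf hn hg hs hy
  have h3 : |f (apx n t x) - f (apx n s y)| ≤ ((1:ℕ) + (1:ℕ)) * eps n :=
    good_gen (hg n le_rfl) _ _ _ _ 1 1 (ceil_t hs).1 (ceil_t ht).1 (ceil_t hs).2 (ceil_t ht).2
      (ceil_x hy) (ceil_x hx) (ceil_near (by positivity) hs.1.le hst)
      (ceil_near (by positivity) ht.1.le (by rwa [abs_sub_comm]))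
      (ceil_near (by positivity) hy.1 hxy)
      (ceil_near (by positivity) hx.1 (by rwa [abs_sub_comm]))
  rw [abs_sub_comm] at h2
  have e : f (t, x) - f (s, y) = (f (t, x) - f (apx n t x)) + (f (apx n t x) - f (apx n s y))
    + (f (apx n s y) - f (s, y)) := by ring
  rw [e]
  refine (abs_add_three _ _ _).trans ?_
  push_cast at h3
  linarith


lemma eps_le {n : ℕ} {q L : ℝ} (h1 : 1 / 2 ^ n ≤ 2 * q) (h2 : (n:ℝ) ≤ 2 * L) (hL : 0 ≤ L) :
    eps n ≤ 16 * Real.sqrt (q * L) := by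
  unfold eps
  have h : Real.sqrt ((n:ℝ) / 2 ^ n) ≤ 2 * Real.sqrt (q * L) := by
    rw [show (2:ℝ) * Real.sqrt (q * L) = Real.sqrt (2 ^ 2 * (q * L)) by
      rw [Real.sqrt_mul (by norm_num : (0:ℝ) ≤ 2 ^ 2) (q * L), Real.sqrt_sq (by norm_num)]]
    apply Real.sqrt_le_sqrt
    have : (n:ℝ) / 2 ^ n = 1 / 2 ^ n * n := by ring
    rw [this]
    calc 1 / 2 ^ n * (n:ℝ) ≤ (2 * q) * (2 * L) := by
          apply mul_le_mul h1 h2 (by positivity)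
          exact le_trans (by positivity) h1
      _ = _ := by ring
  linarith

lemma n_le_log {n : ℕ} {k : ℝ} (hk0 : 0 < k) (hk : k ≤ 1 / 2 ^ n) : (n:ℝ) ≤ 2 * (-Real.log k) := by
  have h := Real.log_le_log hk0 hk
  rw [one_div, Real.log_inv, Real.log_pow] at h
  have h2 := Real.log_two_gt_d9
  have : (0:ℝ) ≤ n := by positivity
  nlinarith

lemma interp {D M h k α : ℝ} (hh : 0 < h) (hk : 0 < k) (hα : α ∈ Icc (0:ℝ) (1/4)) (hM : 0 ≤ M)
    (h1 : D ≤ M * h ^ ((1:ℝ)/4)) (h2 : D ≤ M * k ^ ((1:ℝ)/2)) :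
    D ≤ M * (h ^ ((1:ℝ)/4 - α) * k ^ (2 * α)) := by
  obtain ⟨ha, hb⟩ := hα
  rcases le_total (h ^ ((1:ℝ)/4)) (k ^ ((1:ℝ)/2)) with hc | hc
  · refine h1.trans ?_
    gcongr
    have e1 : h ^ ((1:ℝ)/4) = h ^ ((1:ℝ)/4 - α) * (h ^ ((1:ℝ)/4)) ^ (4 * α) := by
      rw [← Real.rpow_mul hh.le, ← Real.rpow_add hh]; ring_nf
    have e2 : k ^ (2 * α) = (k ^ ((1:ℝ)/2)) ^ (4 * α) := by
      rw [← Real.rpow_mul hk.le]; ring_nf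
    rw [e2]
    nth_rewrite 1 [e1]
    gcongr
  · refine h2.trans ?_
    gcongr
    have e1 : k ^ ((1:ℝ)/2) = (k ^ ((1:ℝ)/2)) ^ (1 - 4 * α) * k ^ (2 * α) := by
      rw [← Real.rpow_mul hk.le, ← Real.rpow_add hk]; ring_nf
    have e2 : h ^ ((1:ℝ)/4 - α) = (h ^ ((1:ℝ)/4)) ^ (1 - 4 * α) := by
      rw [← Real.rpow_mul hh.le]; ring_nf
    rw [e2]
    nth_rewrite 1 [e1]
    gcongr
    linarith

lemma final_bound {f : ℝ × ℝ → ℝ} (hf : ContinuousOn f (Ioc (0:ℝ) 1 ×ˢ Icc (0:ℝ) 1)) {N : ℕ}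
    (hN : 2 ≤ N) (hg : ∀ m ≥ N, Good f m) {α : ℝ} (hα : α ∈ Icc (0:ℝ) (1/4)) {s t x y : ℝ}
    (hs : s ∈ Ioc (0:ℝ) 1) (ht : t ∈ Ioc (0:ℝ) 1) (hx : x ∈ Icc (0:ℝ) 1) (hy : y ∈ Icc (0:ℝ) 1)
    (hst : s ≠ t) (hxy : x ≠ y)
    (hh : |t - s| ≤ 1 / 4 ^ N) (hk : |x - y| ≤ 1 / 4 ^ N) :
    |f (t, y) - f (t, x) - f (s, y) + f (s, x)| ≤
      1728 * (|t - s| ^ ((1:ℝ)/4 - α) * |x - y| ^ (2 * α) *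
                    Real.sqrt (|Real.log (|t - s| * |x - y|)|)) := by
  set h := |t - s| with hh_def
  set k := |x - y| with hk_def
  have hh0 : 0 < h := abs_pos.2 (sub_ne_zero.2 hst.symm)
  have hk0 : 0 < k := abs_pos.2 (sub_ne_zero.2 hxy)
  have hN1 : (1:ℝ) / 4 ^ N ≤ 1 := by
    rw [div_le_one (by positivity)]; exact one_le_pow₀ (by norm_num)
  have hlh : 0 ≤ -Real.log h := by
    linarith [Real.log_nonpos hh0.le (hh.trans hN1)]
  have hlk : 0 ≤ -Real.log k := by
    linarith [Real.log_nonpos hk0.le (hk.trans hN1)]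
  set L := |Real.log (h * k)| with hL_def
  have hL : L = -Real.log h + -Real.log k := by
    rw [hL_def, Real.log_mul hh0.ne' hk0.ne', abs_of_nonpos (by linarith)]; ring
  have hL0 : 0 ≤ L := abs_nonneg _
  have htime : |f (t, y) - f (t, x) - f (s, y) + f (s, x)|
      ≤ 1728 * Real.sqrt L * h ^ ((1:ℝ)/4) := by
    obtain ⟨n, hn1, hn2⟩ := exists_nat_pow_near_of_lt_one hh0 (hh.trans hN1)
      (by norm_num : (0:ℝ) < 1/4) (by norm_num)
    have hn2' : h ≤ 1 / 4 ^ n := by rwa [one_div_pow] at hn2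
    have hnN : N ≤ n := by
      by_contra hcon
      have : ((1:ℝ)/4) ^ N ≤ (1/4) ^ (n + 1) :=
        pow_le_pow_of_le_one (by norm_num) (by norm_num) (by omega)
      rw [one_div_pow] at this
      linarith
    have hgn : ∀ m ≥ n, Good f m := fun m hm => hg m (hnN.trans hm)
    have m1 := modulus hf (hN.trans hnN) hgn hs ht hy hy hn2' (by simp)
    have m2 := modulus hf (hN.trans hnN) hgn hs ht hx hx hn2' (by simp)
    have he : eps n ≤ 16 * Real.sqrt (Real.sqrt h * L) := by
      apply eps_le _ _ hL0
      · have : 1 / 2 ^ (n + 1) ≤ Real.sqrt h := by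
          apply Real.le_sqrt_of_sq_le
          refine le_trans (le_of_eq ?_) hn1.le
          rw [← one_div_pow, ← pow_mul, mul_comm, pow_mul]; norm_num
        rw [pow_succ, one_div, mul_inv] at this
        rw [one_div]
        linarith
      · have : h ≤ 1 / 2 ^ n := by
          refine hn2'.trans ?_
          gcongr
          norm_num
        have := n_le_log hh0 this
        linarith
    have e : Real.sqrt (Real.sqrt h * L) = Real.sqrt L * h ^ ((1:ℝ)/4) := by
      rw [Real.sqrt_mul (Real.sqrt_nonneg h), mul_comm, Real.sqrt_eq_rpow (Real.sqrt h),
        Real.sqrt_eq_rpow h, ← Real.rpow_mul hh0.le]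
      norm_num
    rw [e] at he
    rw [show f (t, y) - f (t, x) - f (s, y) + f (s, x)
      = (f (t, y) - f (s, y)) - (f (t, x) - f (s, x)) by ring]
    refine (abs_sub _ _).trans ?_
    linarith
  have hspace : |f (t, y) - f (t, x) - f (s, y) + f (s, x)|
      ≤ 1728 * Real.sqrt L * k ^ ((1:ℝ)/2) := by
    obtain ⟨n, hn1, hn2⟩ := exists_nat_pow_near_of_lt_one hk0 (hk.trans hN1)
      (by norm_num : (0:ℝ) < 1/2) (by norm_num)
    have hn2' : k ≤ 1 / 2 ^ n := by rwa [one_div_pow] at hn2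
    have hnN : N ≤ n := by
      by_contra hcon
      have : ((1:ℝ)/2) ^ N ≤ (1/2) ^ (n + 1) :=
        pow_le_pow_of_le_one (by norm_num) (by norm_num) (by omega)
      have h3 : (1:ℝ) / 4 ^ N ≤ (1 / 2) ^ N := by
        rw [one_div_pow]
        gcongr
        norm_num
      linarith
    have hgn : ∀ m ≥ n, Good f m := fun m hm => hg m (hnN.trans hm)
    have m1 := modulus hf (hN.trans hnN) hgn ht ht hx hy (by simp) hn2'
    have m2 := modulus hf (hN.trans hnN) hgn hs hs hx hy (by simp) hn2'
    have he : eps n ≤ 16 * Real.sqrt (k * L) := by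
      apply eps_le _ _ hL0
      · rw [pow_succ, one_div_pow] at hn1
        linarith
      · have := n_le_log hk0 hn2'
        linarith
    have e : Real.sqrt (k * L) = Real.sqrt L * k ^ ((1:ℝ)/2) := by
      rw [Real.sqrt_mul hk0.le, mul_comm, Real.sqrt_eq_rpow k]
    rw [e] at he
    rw [show f (t, y) - f (t, x) - f (s, y) + f (s, x)
      = (f (s, x) - f (s, y)) - (f (t, x) - f (t, y)) by ring]
    refine (abs_sub _ _).trans ?_
    linarith
  refine (interp hh0 hk0 hα (by positivity) htime hspace).trans (le_of_eq ?_)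
  ring

end SheAux

/-- **Joint Hölder continuity of the solution of the stochastic heat equation
(Theorem 5.2, second part).** Under the same assumptions, for every `α ∈ [0,1/4]`
there is a deterministic constant `κ_α < ∞` such that almost surely
`lim_{δ↓0} sup { |u(t,y) − u(t,x) − u(s,y) + u(s,x)| /
(|t−s|^{1/4−α} |x−y|^{2α} |log(|t−s||x−y|)|^{1/2}) } ≤ κ_α`; since the supremum is
nonincreasing in `δ`, the limit is expressed as the infimum over `δ > 0`, the
quantities being taken in `ℝ≥0∞`. -/
theorem she_joint_holder_limsup
    {Ω : Type*} [MeasurableSpace Ω] (P : Measure Ω) [IsProbabilityMeasure P]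
    (u : Ω → ℝ × ℝ → ℝ) (humeas : Measurable (Function.uncurry u))
    (hucont : ∀ ω, ContinuousOn (u ω) (Ioc (0:ℝ) 1 ×ˢ Icc (0:ℝ) 1))
    (hlaw : ∀ s ∈ Ioc (0:ℝ) 1, ∀ t ∈ Ioc (0:ℝ) 1, ∀ x ∈ Icc (0:ℝ) 1, ∀ y ∈ Icc (0:ℝ) 1,
      P.map (fun ω => u ω (t, y) - u ω (t, x) - u ω (s, y) + u ω (s, x)) =
        gaussianReal 0 (Real.toNNReal (heatV s t x y))) :
    ∀ α ∈ Icc (0:ℝ) (1/4),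
      ∃ κ : ℝ≥0∞, κ < ⊤ ∧
        ∀ᵐ ω ∂P,
          (⨅ (δ : ℝ) (_ : 0 < δ),
            ⨆ (s : ℝ) (t : ℝ) (x : ℝ) (y : ℝ)
              (_ : s ∈ Ioc (0:ℝ) 1 ∧ t ∈ Ioc (0:ℝ) 1 ∧ x ∈ Icc (0:ℝ) 1 ∧
                   y ∈ Icc (0:ℝ) 1 ∧ s ≠ t ∧ x ≠ y ∧ |t - s| ≤ δ ∧ |x - y| ≤ δ),
              ENNReal.ofReal
                (|u ω (t, y) - u ω (t, x) - u ω (s, y) + u ω (s, x)| /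
                  (|t - s| ^ ((1:ℝ)/4 - α) * |x - y| ^ (2 * α) *
                    Real.sqrt (|Real.log (|t - s| * |x - y|)|)))) ≤ κ := by
  intro α hα
  refine ⟨ENNReal.ofReal 1728, ENNReal.ofReal_lt_top, ?_⟩
  have hm : ∀ p : ℝ × ℝ, Measurable (fun ω => u ω p) := fun p =>
    humeas.comp (measurable_id.prodMk measurable_const)
  have h1 : (1:ℝ) ∈ Ioc (0:ℝ) 1 := by constructor <;> norm_num
  have h0 : (0:ℝ) ∈ Icc (0:ℝ) 1 := by constructor <;> norm_num
  let v : Ω → ℝ × ℝ → ℝ := fun ω p => u ω p - u ω (p.1, 0) - u ω (1, p.2) + u ω (1, 0)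
  have hv : ∀ ω, ContinuousOn (v ω) (Ioc (0:ℝ) 1 ×ˢ Icc (0:ℝ) 1) := by
    intro ω
    have c1 : ContinuousOn (fun p : ℝ × ℝ => u ω (p.1, 0)) (Ioc (0:ℝ) 1 ×ˢ Icc (0:ℝ) 1) :=
      (hucont ω).comp (f := fun p : ℝ × ℝ => (p.1, (0:ℝ))) (by fun_prop) (fun p hp => ⟨hp.1, h0⟩)
    have c2 : ContinuousOn (fun p : ℝ × ℝ => u ω (1, p.2)) (Ioc (0:ℝ) 1 ×ˢ Icc (0:ℝ) 1) :=
      (hucont ω).comp (f := fun p : ℝ × ℝ => ((1:ℝ), p.2)) (by fun_prop) (fun p hp => ⟨h1, hp.2⟩)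
    exact (((hucont ω).sub c1).sub c2).add continuousOn_const
  have hgood := SheAux.ae_good P v (by
      intro n s hs t ht x hx hst
      have e : ∀ ω, v ω (t, x) - v ω (s, x)
          = u ω (t, x) - u ω (t, 0) - u ω (s, x) + u ω (s, 0) := fun ω => by
        simp only [v]; ring
      simp only [e]
      refine SheAux.gauss_tail_eps P (hlaw s hs t ht 0 h0 x hx)
        ((((hm _).sub (hm _)).sub (hm _)).add (hm _)) n ?_
      refine (SheAux.heatV_time hs.1.le ht.1.le 0 x).trans ?_
      have : Real.sqrt |t - s| ≤ 1 / 2 ^ n := by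
        apply Real.sqrt_le_iff.2 ⟨by positivity, hst.trans (le_of_eq ?_)⟩
        rw [div_pow, one_pow, ← pow_mul, mul_comm, pow_mul]; norm_num
      calc 8 * Real.sqrt |t - s| ≤ 8 * (1 / 2 ^ n) := by gcongr
        _ = _ := by ring) (by
      intro n t ht x hx y hy hxy
      have e : ∀ ω, v ω (t, y) - v ω (t, x)
          = u ω (t, y) - u ω (t, x) - u ω (1, y) + u ω (1, x) := fun ω => by
        simp only [v]; ring
      simp only [e]
      refine SheAux.gauss_tail_eps P (hlaw 1 h1 t ht x hx y hy)
        ((((hm _).sub (hm _)).sub (hm _)).add (hm _)) n ?_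
      refine (SheAux.heatV_space h1.1.le ht.1.le x y).trans ?_
      rw [abs_sub_comm] at hxy
      calc 8 * |x - y| ≤ 8 * (1 / 2 ^ n) := by gcongr
        _ = _ := by ring)
  filter_upwards [hgood] with ω hω
  obtain ⟨N, hN⟩ := hω
  refine iInf₂_le_of_le (1 / 4 ^ (N + 2)) (by positivity) ?_
  refine iSup_le fun s => iSup_le fun t => iSup_le fun x => iSup_le fun y => iSup_le fun h => ?_
  obtain ⟨hs, ht, hx, hy, hst, hxy, hh, hk⟩ := h
  apply ENNReal.ofReal_le_ofReal
  apply div_le_of_le_mul₀ (by positivity) (by norm_num)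
  have := SheAux.final_bound (hv ω) (N := N + 2) (by omega) (fun m hm => hN m (by omega)) hα
    hs ht hx hy hst hxy hh hk
  refine le_trans (le_of_eq ?_) this
  congr 1
  simp only [v]; ring
end
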